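/- For every positive integer n, there exists a positive integer B (depending only on n) such that Ω(x) = Ω(x + n) = B for infinitely many positive integers x, where Ω(x) denotes the number of prime factors of x counted with multiplicity. -/

import Mathlib

open Finset

/-- A weak form of the first theorem of Mertens. -/
theorem sum_log_div_prime_le (n : ℕ) (hn : 0 < n) :
    ∑ p ∈ n.primesLE, Real.log p / p ≤ Real.log n + Real.log 4 := by
  have hprime : ∀ p ∈ n.primesLE, p.Prime := fun p hp => Nat.prime_of_mem_primesLE hp
  have hdvd : ∏ p ∈ n.primesLE, p ^ (n / p) ∣ n.factorial := by
    apply Finset.prod_dvd_of_isRelPrime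
    · intro p hp q hq hpq
      exact Nat.coprime_iff_isRelPrime.1
        (Nat.coprime_pow_primes _ _ (hprime p hp) (hprime q hq) hpq)
    · intro p hp
      have hlt : Nat.log p n < Nat.log p n + 2 := by omega
      rw [(hprime p hp).pow_dvd_factorial_iff hlt]
      have h1 : 1 ∈ Finset.Ico 1 (Nat.log p n + 2) := by simp
      simpa using Finset.single_le_sum (f := fun i => n / p ^ i) (fun i _ => Nat.zero_le _) h1
  have hle : ∑ p ∈ n.primesLE, ((n / p : ℕ) : ℝ) * Real.log p ≤ n * Real.log n := by
    have h1 : ((∏ p ∈ n.primesLE, p ^ (n / p) : ℕ) : ℝ) ≤ (n : ℝ) ^ n := by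
      exact_mod_cast (Nat.le_of_dvd n.factorial_pos hdvd).trans (Nat.factorial_le_pow n)
    have h2 := Real.log_le_log (by
      exact_mod_cast Finset.prod_pos fun p hp => pow_pos (hprime p hp).pos _) h1
    rw [Real.log_pow] at h2
    push_cast at h2
    rw [Real.log_prod (fun p hp => by
      have := (hprime p hp).pos
      positivity)] at h2
    simpa using h2
  have htheta : ∑ p ∈ n.primesLE, Real.log p ≤ Real.log 4 * n := by
    rw [← Chebyshev.theta_eq_sum_primesLE_log]
    exact Chebyshev.theta_le_log4_mul_x (Nat.cast_nonneg n)
  have hn' : (0 : ℝ) < n := by exact_mod_cast hn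
  have key : n * ∑ p ∈ n.primesLE, Real.log p / p ≤ n * (Real.log n + Real.log 4) := by
    calc n * ∑ p ∈ n.primesLE, Real.log p / p
        ≤ ∑ p ∈ n.primesLE, (((n / p : ℕ) : ℝ) * Real.log p + Real.log p) := by
          rw [Finset.mul_sum]
          refine Finset.sum_le_sum fun p hp => ?_
          have hp0 : (0 : ℝ) < p := by exact_mod_cast (hprime p hp).pos
          have h1 : (n : ℝ) / p ≤ ((n / p : ℕ) : ℝ) + 1 := by
            rw [← Nat.floor_div_eq_div (K := ℝ)]
            exact (Nat.lt_floor_add_one _).le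
          have h2 : 0 ≤ Real.log p := Real.log_natCast_nonneg p
          calc (n : ℝ) * (Real.log p / p) = n / p * Real.log p := by ring
            _ ≤ (((n / p : ℕ) : ℝ) + 1) * Real.log p := by gcongr
            _ = _ := by ring
      _ ≤ n * (Real.log n + Real.log 4) := by
          rw [Finset.sum_add_distrib]
          linarith
  exact le_of_mul_le_mul_left key hn'

theorem sum_log_div_le {s : Finset ℕ} {u : ℝ} (hu : 0 ≤ u) (hs : ∀ p ∈ s, p.Prime)
    (hsu : ∀ p ∈ s, Real.log p ≤ u) : ∑ p ∈ s, Real.log p / p ≤ u + Real.log 4 := by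
  have hn : 0 < ⌊Real.exp u⌋₊ := Nat.floor_pos.2 (Real.one_le_exp hu)
  have hsub : s ⊆ (⌊Real.exp u⌋₊).primesLE := by
    intro p hp
    rw [Nat.mem_primesLE]
    refine ⟨Nat.le_floor ?_, hs p hp⟩
    exact (Real.log_le_iff_le_exp (by exact_mod_cast (hs p hp).pos)).1 (hsu p hp)
  calc ∑ p ∈ s, Real.log p / p ≤ ∑ p ∈ (⌊Real.exp u⌋₊).primesLE, Real.log p / p :=
        Finset.sum_le_sum_of_subset_of_nonneg hsub fun p _ _ =>
          div_nonneg (Real.log_natCast_nonneg p) (Nat.cast_nonneg p)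
    _ ≤ Real.log ⌊Real.exp u⌋₊ + Real.log 4 := sum_log_div_prime_le _ hn
    _ ≤ u + Real.log 4 := by
        gcongr
        rw [Real.log_le_iff_le_exp (by exact_mod_cast hn)]
        exact Nat.floor_le (Real.exp_pos u).le

/-- The sum over a period of a product of functions with coprime periods. -/
theorem sum_range_mul_of_coprime {a b : ℕ} (hab : a.Coprime b) (ha : 0 < a) (hb : 0 < b)
    {f g : ℕ → ℝ} (hf : Function.Periodic f a) (hg : Function.Periodic g b) :
    ∑ t ∈ range (a * b), f t * g t = (∑ t ∈ range a, f t) * ∑ t ∈ range b, g t := by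
  rw [Finset.sum_mul_sum, ← Finset.sum_product']
  refine Finset.sum_nbij' (fun t => (t % a, t % b))
    (fun x => (Nat.chineseRemainder hab x.1 x.2 : ℕ)) ?_ ?_ ?_ ?_ ?_
  · intro t _
    simp [Nat.mod_lt _ ha, Nat.mod_lt _ hb]
  · intro x _
    simpa using Nat.chineseRemainder_lt_mul hab x.1 x.2 ha.ne' hb.ne'
  · intro t ht
    have := Nat.chineseRemainder_modEq_unique hab (a := t % a) (b := t % b) (z := t)
      (Nat.mod_modEq t a).symm (Nat.mod_modEq t b).symm
    exact (Nat.ModEq.eq_of_lt_of_lt this (by simpa using ht)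
      (Nat.chineseRemainder_lt_mul hab _ _ ha.ne' hb.ne')).symm
  · intro x hx
    simp only [mem_product, mem_range] at hx
    have h1 := (Nat.chineseRemainder hab x.1 x.2).2.1
    have h2 := (Nat.chineseRemainder hab x.1 x.2).2.2
    ext
    · exact Nat.mod_eq_of_modEq h1 hx.1
    · exact Nat.mod_eq_of_modEq h2 hx.2
  · intro t _
    simp only [hf.map_mod_nat, hg.map_mod_nat]

theorem Function.Periodic.of_dvd {f : ℕ → ℝ} {a b : ℕ} (hf : Function.Periodic f a)
    (hab : a ∣ b) : Function.Periodic f b := by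
  obtain ⟨c, rfl⟩ := hab
  rw [mul_comm]
  simpa using hf.nat_mul c

theorem periodic_prod {ι : Type*} (s : Finset ι) (m : ι → ℕ) (F : ι → ℕ → ℝ)
    (hF : ∀ i ∈ s, Function.Periodic (F i) (m i)) :
    Function.Periodic (fun t => ∏ i ∈ s, F i t) (∏ i ∈ s, m i) := by
  intro t
  refine Finset.prod_congr rfl fun i hi => ?_
  exact (hF i hi).of_dvd (Finset.dvd_prod_of_mem m hi) t

theorem sum_range_prod_of_coprime {s : Finset ℕ} (hs : ∀ p ∈ s, p.Prime) {F : ℕ → ℕ → ℝ}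
    (hF : ∀ p ∈ s, Function.Periodic (F p) p) :
    ∑ t ∈ range (∏ p ∈ s, p), ∏ p ∈ s, F p t = ∏ p ∈ s, ∑ t ∈ range p, F p t := by
  induction s using Finset.induction_on with
  | empty => simp
  | insert q s hq ih =>
    simp only [Finset.prod_insert hq]
    simp only [Finset.forall_mem_insert] at hs hF
    rw [sum_range_mul_of_coprime _ hs.1.pos (Finset.prod_pos fun p hp => (hs.2 p hp).pos) hF.1
      (periodic_prod s (fun p => p) F hF.2), ih hs.2 hF.2]
    refine Nat.Coprime.prod_right fun p hp => ?_
    exact (Nat.coprime_primes hs.1 (hs.2 p hp)).2 fun h => hq (h ▸ hp)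

theorem sum_Ico_add_period {f : ℕ → ℝ} {q : ℕ} (hf : Function.Periodic f q) (T : ℕ) :
    ∑ t ∈ Ico T (T + q), f t = ∑ t ∈ range q, f t := by
  induction T with
  | zero => simp
  | succ T ih =>
    rw [← ih]
    have h1 := Finset.sum_Ico_succ_top (show T ≤ T + q by omega) f
    have h2 := Finset.sum_eq_sum_Ico_succ_bot (show T < T + q + 1 by omega) f
    rw [hf T] at h1
    rw [show T + 1 + q = T + q + 1 by ring]
    linarith

theorem sum_Ico_add_mul_period {f : ℕ → ℝ} {q : ℕ} (hf : Function.Periodic f q) (T c : ℕ) :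
    ∑ t ∈ Ico T (T + q * c), f t = c * ∑ t ∈ range q, f t := by
  induction c with
  | zero => simp
  | succ c ih =>
    rw [← Finset.sum_Ico_consecutive f (show T ≤ T + q * c by omega)
      (show T + q * c ≤ T + q * (c + 1) by rw [mul_add]; omega), ih,
      show T + q * (c + 1) = T + q * c + q by ring, sum_Ico_add_period hf]
    push_cast
    ring

theorem abs_sum_Ico_sub_le {f : ℕ → ℝ} {q : ℕ} (hq : 0 < q) (hf : Function.Periodic f q)
    (hf1 : ∀ t, |f t| ≤ 1) (T N : ℕ) :
    |∑ t ∈ Ico T (T + N), f t - N * ((∑ t ∈ range q, f t) / q)| ≤ 2 * q := by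
  have hq' : (0 : ℝ) < q := by exact_mod_cast hq
  have hmod : ((N % q : ℕ) : ℝ) ≤ q := by exact_mod_cast (Nat.mod_lt N hq).le
  have hN : (N : ℝ) = q * (N / q : ℕ) + (N % q : ℕ) := by exact_mod_cast (Nat.div_add_mod N q).symm
  have hsplit := Finset.sum_Ico_consecutive f (show T ≤ T + q * (N / q) by omega)
    (show T + q * (N / q) ≤ T + N by have := Nat.mul_div_le N q; omega)
  rw [sum_Ico_add_mul_period hf] at hsplit
  have hrest : |∑ t ∈ Ico (T + q * (N / q)) (T + N), f t| ≤ q := by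
    refine (Finset.abs_sum_le_sum_abs _ _).trans ?_
    refine (Finset.sum_le_card_nsmul _ _ 1 fun t _ => hf1 t).trans ?_
    have : T + N - (T + q * (N / q)) = N % q := by
      have := Nat.div_add_mod N q
      omega
    simpa [this] using hmod
  have hmean : |(∑ t ∈ range q, f t) / q| ≤ 1 := by
    rw [abs_div, Nat.abs_cast, div_le_one hq']
    refine (Finset.abs_sum_le_sum_abs _ _).trans ?_
    simpa using Finset.sum_le_card_nsmul (range q) _ 1 fun t _ => hf1 t
  have heq : ∑ t ∈ Ico T (T + N), f t - N * ((∑ t ∈ range q, f t) / q) =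
      ∑ t ∈ Ico (T + q * (N / q)) (T + N), f t -
        (N % q : ℕ) * ((∑ t ∈ range q, f t) / q) := by
    rw [← hsplit]
    nth_rewrite 1 [hN]
    field_simp
    ring
  rw [heq]
  refine (abs_sub _ _).trans ?_
  rw [abs_mul, Nat.abs_cast]
  have : ((N % q : ℕ) : ℝ) * |(∑ t ∈ range q, f t) / q| ≤ q * 1 := by gcongr
  linarith

open scoped Classical in
/-- The number of residue classes modulo `p` removed by the sieve. -/
noncomputable def siftedCard (Z : ℕ → ℕ → Prop) (p : ℕ) : ℕ := #{t ∈ range p | Z p t}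

/-- The multiplicative weight `ρ / (p - ρ)` at a prime `p`, where `ρ` classes are removed. -/
noncomputable def sieveWeight (Z : ℕ → ℕ → Prop) (p : ℕ) : ℝ :=
  siftedCard Z p / (p - siftedCard Z p)

open scoped Classical in
/-- A function of mean zero modulo `p` which is constant on removed and on kept classes. -/
noncomputable def sieveFun (Z : ℕ → ℕ → Prop) (p t : ℕ) : ℝ :=
  if Z p t then -1 else sieveWeight Z p

/-- A set `P` of primes, for each of which at most `k` residue classes are to be removed. -/
structure IsSieve (k : ℕ) (P : Finset ℕ) (Z : ℕ → ℕ → Prop) : Prop where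
  prime : ∀ p ∈ P, p.Prime
  periodic : ∀ p ∈ P, ∀ t, Z p (t + p) ↔ Z p t
  card_le : ∀ p ∈ P, siftedCard Z p ≤ k
  two_mul_lt : ∀ p ∈ P, 2 * k < p

namespace IsSieve

variable {k : ℕ} {P : Finset ℕ} {Z : ℕ → ℕ → Prop}

theorem mono (hS : IsSieve k P Z) {U : Finset ℕ} (hU : U ⊆ P) : IsSieve k U Z where
  prime p hp := hS.prime p (hU hp)
  periodic p hp := hS.periodic p (hU hp)
  card_le p hp := hS.card_le p (hU hp)
  two_mul_lt p hp := hS.two_mul_lt p (hU hp)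

theorem two_mul_card_lt (hS : IsSieve k P Z) {p : ℕ} (hp : p ∈ P) :
    2 * (siftedCard Z p : ℝ) < p := by
  have := hS.card_le p hp
  have := hS.two_mul_lt p hp
  exact_mod_cast (show 2 * siftedCard Z p < p by omega)

theorem weight_nonneg (hS : IsSieve k P Z) {p : ℕ} (hp : p ∈ P) : 0 ≤ sieveWeight Z p := by
  have h := hS.two_mul_card_lt hp
  have h0 : (0 : ℝ) ≤ siftedCard Z p := Nat.cast_nonneg _
  exact div_nonneg h0 (by linarith)

theorem weight_le_one (hS : IsSieve k P Z) {p : ℕ} (hp : p ∈ P) : sieveWeight Z p ≤ 1 := by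
  have h := hS.two_mul_card_lt hp
  have h0 : (0 : ℝ) ≤ siftedCard Z p := Nat.cast_nonneg _
  exact div_le_one_of_le₀ (by linarith) (by linarith)

theorem weight_le (hS : IsSieve k P Z) {p : ℕ} (hp : p ∈ P) : sieveWeight Z p ≤ 2 * k / p := by
  have h := hS.two_mul_card_lt hp
  have h0 : (0 : ℝ) ≤ siftedCard Z p := Nat.cast_nonneg _
  have h1 : (siftedCard Z p : ℝ) ≤ k := by exact_mod_cast hS.card_le p hp
  rw [sieveWeight, div_le_div_iff₀ (by linarith) (by linarith)]
  nlinarith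

theorem prod_weight_nonneg (hS : IsSieve k P Z) {r : Finset ℕ} (hr : r ⊆ P) :
    0 ≤ ∏ p ∈ r, sieveWeight Z p :=
  Finset.prod_nonneg fun _ hp => hS.weight_nonneg (hr hp)

theorem abs_sieveFun_le (hS : IsSieve k P Z) {p : ℕ} (hp : p ∈ P) (t : ℕ) :
    |sieveFun Z p t| ≤ 1 := by
  unfold sieveFun
  split_ifs
  · simp
  · rw [abs_of_nonneg (hS.weight_nonneg hp)]
    exact hS.weight_le_one hp

theorem periodic_sieveFun (hS : IsSieve k P Z) {p : ℕ} (hp : p ∈ P) :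
    Function.Periodic (sieveFun Z p) p := by
  intro t
  unfold sieveFun
  classical exact if_congr (hS.periodic p hp t) rfl rfl

theorem sum_range_ite (p : ℕ) (x y : ℝ) [DecidablePred (Z p)] :
    ∑ t ∈ range p, (if Z p t then x else y) = siftedCard Z p * x + (p - siftedCard Z p) * y := by
  have h := Finset.card_filter_add_card_filter_not (s := range p) (Z p)
  have h1 : #{t ∈ range p | Z p t} = siftedCard Z p := by
    unfold siftedCard
    congr
  rw [h1, card_range] at h
  have h2 : (p : ℝ) - siftedCard Z p = (#{t ∈ range p | ¬ Z p t} : ℕ) := by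
    rw [sub_eq_iff_eq_add']
    exact_mod_cast h.symm
  rw [Finset.sum_ite, Finset.sum_const, Finset.sum_const, h2, h1, nsmul_eq_mul, nsmul_eq_mul]

theorem sum_sieveFun (hS : IsSieve k P Z) {p : ℕ} (hp : p ∈ P) :
    ∑ t ∈ range p, sieveFun Z p t = 0 := by
  have h := hS.two_mul_card_lt hp
  have h0 : (0 : ℝ) ≤ siftedCard Z p := Nat.cast_nonneg _
  unfold sieveFun
  rw [sum_range_ite, sieveWeight, mul_div_cancel₀ _ (by linarith)]
  ring

theorem sum_sieveFun_mul_self (hS : IsSieve k P Z) {p : ℕ} (hp : p ∈ P) :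
    ∑ t ∈ range p, sieveFun Z p t * sieveFun Z p t = p * sieveWeight Z p := by
  have h := hS.two_mul_card_lt hp
  have h0 : (0 : ℝ) ≤ siftedCard Z p := Nat.cast_nonneg _
  have h1 : (p : ℝ) - siftedCard Z p ≠ 0 := by linarith
  unfold sieveFun
  simp only [mul_ite, ite_mul]
  classical
  have : ∀ t, (if Z p t then (if Z p t then (-1 : ℝ) * -1 else sieveWeight Z p * -1) else
      if Z p t then -1 * sieveWeight Z p else sieveWeight Z p * sieveWeight Z p) =
      if Z p t then 1 else sieveWeight Z p * sieveWeight Z p := by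
    intro t
    split_ifs <;> norm_num
  simp only [this]
  rw [sum_range_ite, sieveWeight]
  field_simp
  ring

/-- Products of sieve functions are orthogonal on average. -/
theorem abs_sum_prod_mul_prod_sub_le (hS : IsSieve k P Z) {r s : Finset ℕ} (hr : r ⊆ P)
    (hs : s ⊆ P) {m : ℕ} (hm : 0 < m) (hmP : ∀ p ∈ P, m.Coprime p) {f : ℕ → ℝ}
    (hf : Function.Periodic f m) (hf1 : ∀ t, |f t| ≤ 1) (T N : ℕ) :
    |∑ t ∈ Ico T (T + N), f t * ((∏ p ∈ r, sieveFun Z p t) * ∏ p ∈ s, sieveFun Z p t) -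
      N * ((∑ t ∈ range m, f t) / m) * (if r = s then ∏ p ∈ r, sieveWeight Z p else 0)| ≤
      2 * m * ((∏ p ∈ r, (p : ℝ)) * ∏ p ∈ s, (p : ℝ)) := by
  have hUP : r ∪ s ⊆ P := Finset.union_subset hr hs
  have hpos : ∀ p ∈ P, (0 : ℝ) < p := fun p hp => by exact_mod_cast (hS.prime p hp).pos
  set ψ : ℕ → ℕ → ℝ := fun p t =>
    (if p ∈ r then sieveFun Z p t else 1) * (if p ∈ s then sieveFun Z p t else 1) with hψ
  have hprod : ∀ t, (∏ p ∈ r, sieveFun Z p t) * ∏ p ∈ s, sieveFun Z p t =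
      ∏ p ∈ r ∪ s, ψ p t := by
    intro t
    rw [hψ, Finset.prod_mul_distrib, Finset.prod_ite_mem, Finset.prod_ite_mem,
      Finset.inter_eq_right.2 Finset.subset_union_left,
      Finset.inter_eq_right.2 Finset.subset_union_right]
  have hψper : ∀ p ∈ r ∪ s, Function.Periodic (ψ p) p := by
    intro p hp t
    simp only [hψ, hS.periodic_sieveFun (hUP hp) t]
  have hψ1 : ∀ p ∈ r ∪ s, ∀ t, |ψ p t| ≤ 1 := by
    intro p hp t
    have h1 := hS.abs_sieveFun_le (hUP hp) t
    simp only [hψ, abs_mul]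
    refine mul_le_one₀ ?_ (abs_nonneg _) ?_ <;> split_ifs <;> simp [h1]
  have hprime : ∀ p ∈ r ∪ s, p.Prime := fun p hp => hS.prime p (hUP hp)
  have hMpos : 0 < ∏ p ∈ r ∪ s, p := Finset.prod_pos fun p hp => (hprime p hp).pos
  have hperU := periodic_prod (r ∪ s) (fun p => p) ψ hψper
  have hcop : m.Coprime (∏ p ∈ r ∪ s, p) :=
    Nat.Coprime.prod_right fun p hp => hmP p (hUP hp)
  have hper : Function.Periodic (fun t => f t * ∏ p ∈ r ∪ s, ψ p t) (m * ∏ p ∈ r ∪ s, p) := by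
    intro t
    have h1 := hf.of_dvd (Dvd.intro (∏ p ∈ r ∪ s, p) rfl) t
    have h2 := hperU.of_dvd (Dvd.intro_left m rfl) t
    simp only at h2 ⊢
    rw [h1, h2]
  have hb : ∀ t, |f t * ∏ p ∈ r ∪ s, ψ p t| ≤ 1 := by
    intro t
    rw [abs_mul, Finset.abs_prod]
    exact mul_le_one₀ (hf1 t) (Finset.prod_nonneg fun _ _ => abs_nonneg _)
      (Finset.prod_le_one (fun _ _ => abs_nonneg _) fun p hp => hψ1 p hp t)
  have hmain := abs_sum_Ico_sub_le (Nat.mul_pos hm hMpos) hper hb T N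
  have hmean : (∏ p ∈ r ∪ s, ∑ t ∈ range p, ψ p t) =
      (∏ p ∈ r ∪ s, (p : ℝ)) * (if r = s then ∏ p ∈ r, sieveWeight Z p else 0) := by
    split_ifs with hrs
    · subst hrs
      rw [Finset.union_idempotent, ← Finset.prod_mul_distrib]
      refine Finset.prod_congr rfl fun p hp => ?_
      simp only [hψ, if_pos hp]
      exact hS.sum_sieveFun_mul_self (hr hp)
    · rw [mul_zero]
      obtain ⟨p, hp⟩ : ∃ p, ¬ (p ∈ r ↔ p ∈ s) := by
        by_contra! h
        exact hrs (Finset.ext h)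
      have hpU : p ∈ r ∪ s := by
        rw [Finset.mem_union]
        tauto
      refine Finset.prod_eq_zero hpU ?_
      rw [← hS.sum_sieveFun (hUP hpU)]
      refine Finset.sum_congr rfl fun t _ => ?_
      simp only [hψ]
      by_cases h1 : p ∈ r
      · have h2 : p ∉ s := by tauto
        simp [h1, h2]
      · have h2 : p ∈ s := by tauto
        simp [h1, h2]
  rw [sum_range_mul_of_coprime hcop hm hMpos hf hperU, sum_range_prod_of_coprime hprime hψper,
    hmean] at hmain
  have hMpos' : (0 : ℝ) < ∏ p ∈ r ∪ s, (p : ℝ) := Finset.prod_pos fun p hp => hpos p (hUP hp)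
  have hm' : (0 : ℝ) < m := by exact_mod_cast hm
  simp only [hprod]
  push_cast at hmain
  have heq : (∑ t ∈ range m, f t) * ((∏ p ∈ r ∪ s, (p : ℝ)) *
      (if r = s then ∏ p ∈ r, sieveWeight Z p else 0)) / (m * ∏ p ∈ r ∪ s, (p : ℝ)) =
      (∑ t ∈ range m, f t) / m * (if r = s then ∏ p ∈ r, sieveWeight Z p else 0) := by
    field_simp
  rw [heq, ← mul_assoc, ← mul_assoc] at hmain
  refine hmain.trans (mul_le_mul_of_nonneg_left ?_ (by positivity))
  rw [← Finset.prod_union_inter]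
  refine le_mul_of_one_le_right hMpos'.le ?_
  rw [← Nat.cast_prod, Nat.one_le_cast]
  refine Finset.one_le_prod' fun p hp => ?_
  exact (hS.prime p (hr (Finset.mem_inter.1 hp).1)).one_le

theorem card_prod_le (hS : IsSieve k P Z) (R : ℕ) :
    #{r ∈ P.powerset | ∏ p ∈ r, p ≤ R} ≤ R := by
  have h : #{r ∈ P.powerset | ∏ p ∈ r, p ≤ R} ≤ #(Icc 1 R) := by
    refine Finset.card_le_card_of_injOn (fun r => ∏ p ∈ r, p) ?_ ?_
    · intro r hr
      simp only [coe_filter, mem_powerset, Set.mem_ofPred_eq] at hr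
      simp only [coe_Icc, Set.mem_Icc]
      exact ⟨Finset.prod_pos fun p hp => (hS.prime p (hr.1 hp)).pos, hr.2⟩
    · intro r hr s hs hrs
      simp only [coe_filter, mem_powerset, Set.mem_ofPred_eq] at hr hs
      rw [← Nat.primeFactors_prod fun p hp => hS.prime p (hr.1 hp),
        ← Nat.primeFactors_prod fun p hp => hS.prime p (hs.1 hp)]
      exact congrArg Nat.primeFactors hrs
  simpa using h

/-- The mean value of the square of a short combination of products of sieve functions. -/
theorem abs_sum_sq_sub_le (hS : IsSieve k P Z) {z : Finset ℕ → ℝ} {R : ℕ}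
    (hz1 : ∀ r ⊆ P, |z r| ≤ 1) (hzR : ∀ r ⊆ P, z r ≠ 0 → ∏ p ∈ r, p ≤ R)
    {m : ℕ} (hm : 0 < m) (hmP : ∀ p ∈ P, m.Coprime p) {f : ℕ → ℝ}
    (hf : Function.Periodic f m) (hf1 : ∀ t, |f t| ≤ 1) (T N : ℕ) :
    |∑ t ∈ Ico T (T + N), f t * (∑ r ∈ P.powerset, z r * ∏ p ∈ r, sieveFun Z p t) ^ 2 -
      N * ((∑ t ∈ range m, f t) / m) * ∑ r ∈ P.powerset, (∏ p ∈ r, sieveWeight Z p) * z r ^ 2| ≤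
      2 * m * (R : ℝ) ^ 4 := by
  have hexp : ∑ t ∈ Ico T (T + N), f t * (∑ r ∈ P.powerset, z r * ∏ p ∈ r, sieveFun Z p t) ^ 2 -
      N * ((∑ t ∈ range m, f t) / m) * ∑ r ∈ P.powerset, (∏ p ∈ r, sieveWeight Z p) * z r ^ 2 =
      ∑ r ∈ P.powerset, ∑ s ∈ P.powerset, z r * z s *
        (∑ t ∈ Ico T (T + N), f t * ((∏ p ∈ r, sieveFun Z p t) * ∏ p ∈ s, sieveFun Z p t) -
        N * ((∑ t ∈ range m, f t) / m) * (if r = s then ∏ p ∈ r, sieveWeight Z p else 0)) := by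
    simp only [mul_sub, Finset.sum_sub_distrib]
    congr 1
    · simp only [sq, Finset.sum_mul_sum]
      simp only [Finset.mul_sum]
      rw [Finset.sum_comm]
      refine Finset.sum_congr rfl fun r _ => ?_
      rw [Finset.sum_comm]
      refine Finset.sum_congr rfl fun s _ => Finset.sum_congr rfl fun t _ => ?_
      ring
    · rw [Finset.mul_sum]
      refine Finset.sum_congr rfl fun r hr => ?_
      simp only [mul_ite, mul_zero, Finset.sum_ite_eq, hr, if_true]
      ring
  rw [hexp]
  have hsum : ∑ r ∈ P.powerset, |z r| * ∏ p ∈ r, (p : ℝ) ≤ (R : ℝ) ^ 2 := by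
    have hsub : ∑ r ∈ P.powerset with ∏ p ∈ r, p ≤ R, |z r| * ∏ p ∈ r, (p : ℝ) =
        ∑ r ∈ P.powerset, |z r| * ∏ p ∈ r, (p : ℝ) := by
      refine Finset.sum_filter_of_ne fun r hr hne => ?_
      refine hzR r (Finset.mem_powerset.1 hr) fun h0 => hne ?_
      simp [h0]
    rw [← hsub]
    calc ∑ r ∈ P.powerset with ∏ p ∈ r, p ≤ R, |z r| * ∏ p ∈ r, (p : ℝ)
        ≤ #{r ∈ P.powerset | ∏ p ∈ r, p ≤ R} • (R : ℝ) := by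
          refine Finset.sum_le_card_nsmul _ _ _ fun r hr => ?_
          rw [Finset.mem_filter, Finset.mem_powerset] at hr
          have h1 : ∏ p ∈ r, (p : ℝ) ≤ R := by
            rw [← Nat.cast_prod]
            exact Nat.cast_le.2 hr.2
          have h0 : (0 : ℝ) ≤ ∏ p ∈ r, (p : ℝ) := Finset.prod_nonneg fun _ _ => Nat.cast_nonneg _
          calc |z r| * ∏ p ∈ r, (p : ℝ) ≤ 1 * R := by
                gcongr
                exact hz1 r hr.1
            _ = R := one_mul _
      _ ≤ (R : ℝ) ^ 2 := by
          rw [nsmul_eq_mul, sq]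
          gcongr
          exact_mod_cast hS.card_prod_le R
  calc _ ≤ ∑ r ∈ P.powerset, ∑ s ∈ P.powerset,
        |z r| * |z s| * (2 * m * ((∏ p ∈ r, (p : ℝ)) * ∏ p ∈ s, (p : ℝ))) := by
        refine (Finset.abs_sum_le_sum_abs _ _).trans (Finset.sum_le_sum fun r hr => ?_)
        refine (Finset.abs_sum_le_sum_abs _ _).trans (Finset.sum_le_sum fun s hs => ?_)
        rw [abs_mul, abs_mul]
        gcongr
        exact hS.abs_sum_prod_mul_prod_sub_le (Finset.mem_powerset.1 hr)
          (Finset.mem_powerset.1 hs) hm hmP hf hf1 T N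
    _ = 2 * m * (∑ r ∈ P.powerset, |z r| * ∏ p ∈ r, (p : ℝ)) ^ 2 := by
        rw [sq, Finset.sum_mul_sum, Finset.mul_sum]
        refine Finset.sum_congr rfl fun r _ => ?_
        rw [Finset.mul_sum]
        refine Finset.sum_congr rfl fun s _ => ?_
        ring
    _ ≤ 2 * m * ((R : ℝ) ^ 2) ^ 2 := by
        have : 0 ≤ ∑ r ∈ P.powerset, |z r| * ∏ p ∈ r, (p : ℝ) :=
          Finset.sum_nonneg fun r _ =>
            mul_nonneg (abs_nonneg _) (Finset.prod_nonneg fun _ _ => Nat.cast_nonneg _)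
        gcongr
    _ = 2 * m * (R : ℝ) ^ 4 := by ring

end IsSieve

theorem sum_powerset_erase {P : Finset ℕ} {p : ℕ} (hp : p ∈ P) (f : Finset ℕ → ℝ) :
    ∑ r ∈ P.powerset, f r = ∑ r ∈ (P.erase p).powerset, (f r + f (insert p r)) := by
  conv_lhs => rw [← Finset.insert_erase hp]
  rw [Finset.sum_powerset_insert (Finset.notMem_erase p P), Finset.sum_add_distrib]

/-- The logarithm of the product of the elements. -/
noncomputable def logSize (r : Finset ℕ) : ℝ := ∑ p ∈ r, Real.log p

theorem logSize_nonneg (r : Finset ℕ) : 0 ≤ logSize r :=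
  Finset.sum_nonneg fun p _ => Real.log_natCast_nonneg p

theorem logSize_insert {r : Finset ℕ} {p : ℕ} (hp : p ∉ r) :
    logSize (insert p r) = Real.log p + logSize r :=
  Finset.sum_insert hp

/-- Linearly decreasing coefficients for the sieve of level `exp ℓ`. -/
noncomputable def cutoff (ℓ : ℝ) (r : Finset ℕ) : ℝ := max 0 (1 - logSize r / ℓ)

section cutoff

variable {ℓ : ℝ}

theorem cutoff_nonneg (ℓ : ℝ) (r : Finset ℕ) : 0 ≤ cutoff ℓ r := le_max_left _ _

theorem cutoff_le_one (hℓ : 0 < ℓ) (r : Finset ℕ) : cutoff ℓ r ≤ 1 := by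
  have := div_nonneg (logSize_nonneg r) hℓ.le
  exact max_le zero_le_one (by linarith)

theorem cutoff_of_le (hℓ : 0 < ℓ) {r : Finset ℕ} (h : logSize r ≤ ℓ) :
    cutoff ℓ r = 1 - logSize r / ℓ := by
  have := (div_le_one hℓ).2 h
  exact max_eq_right (by linarith)

theorem cutoff_of_lt (hℓ : 0 < ℓ) {r : Finset ℕ} (h : ℓ < logSize r) : cutoff ℓ r = 0 := by
  have := (one_lt_div hℓ).2 h
  exact max_eq_left (by linarith)

theorem logSize_le_of_cutoff_ne_zero (hℓ : 0 < ℓ) {r : Finset ℕ} (h : cutoff ℓ r ≠ 0) :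
    logSize r ≤ ℓ := by
  by_contra! h'
  exact h (cutoff_of_lt hℓ h')

theorem cutoff_insert_le (hℓ : 0 < ℓ) {r : Finset ℕ} {p : ℕ} (hp : p ∉ r) :
    cutoff ℓ (insert p r) ≤ cutoff ℓ r := by
  have := Real.log_natCast_nonneg p
  unfold cutoff
  rw [logSize_insert hp]
  gcongr
  linarith

theorem cutoff_sub_cutoff_insert_le (hℓ : 0 < ℓ) {r : Finset ℕ} {p : ℕ} (hp : p ∉ r) :
    cutoff ℓ r - cutoff ℓ (insert p r) ≤ Real.log p / ℓ := by
  have h0 : 0 ≤ Real.log p / ℓ := div_nonneg (Real.log_natCast_nonneg p) hℓ.le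
  have h1 : 1 - logSize r / ℓ - Real.log p / ℓ ≤ cutoff ℓ (insert p r) := by
    refine le_trans (le_of_eq ?_) (le_max_right _ _)
    rw [logSize_insert hp]
    ring
  have h2 := cutoff_nonneg ℓ (insert p r)
  rw [sub_le_iff_le_add]
  exact max_le (by linarith) (by linarith)

end cutoff

namespace IsSieve

variable {k : ℕ} {P : Finset ℕ} {Z : ℕ → ℕ → Prop} {ℓ : ℝ}

theorem sum_weight_mul_logSize_le (hS : IsSieve k P Z) (ℓ : ℝ) :
    ∑ r ∈ P.powerset with logSize r ≤ ℓ, (∏ p ∈ r, sieveWeight Z p) * logSize r ≤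
      2 * k * ∑ r ∈ P.powerset with logSize r ≤ ℓ,
        (∏ p ∈ r, sieveWeight Z p) * (ℓ - logSize r + Real.log 4) := by
  have hlog : ∀ p : ℕ, 0 ≤ Real.log p := fun p => Real.log_natCast_nonneg p
  set w : Finset ℕ → ℝ := fun r => ∏ p ∈ r, sieveWeight Z p with hw
  have hw0 : ∀ r ∈ P.powerset, 0 ≤ w r := fun r hr =>
    hS.prod_weight_nonneg (Finset.mem_powerset.1 hr)
  calc ∑ r ∈ P.powerset with logSize r ≤ ℓ, w r * logSize r
      = ∑ r ∈ P.powerset, ∑ p ∈ P,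
          if p ∈ r ∧ logSize r ≤ ℓ then w r * Real.log p else 0 := by
        rw [Finset.sum_filter]
        refine Finset.sum_congr rfl fun r hr => ?_
        by_cases h : logSize r ≤ ℓ
        · simp only [h, and_true, if_true]
          rw [Finset.sum_ite_mem, Finset.inter_eq_right.2 (Finset.mem_powerset.1 hr), logSize,
            Finset.mul_sum]
        · simp [h]
    _ = ∑ p ∈ P, ∑ r ∈ (P.erase p).powerset,
          if Real.log p ≤ ℓ - logSize r then w r * (sieveWeight Z p * Real.log p) else 0 := by
        rw [Finset.sum_comm]
        refine Finset.sum_congr rfl fun p hp => ?_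
        rw [sum_powerset_erase hp]
        refine Finset.sum_congr rfl fun r hr => ?_
        have hpr : p ∉ r := fun h => Finset.notMem_erase p P (Finset.mem_powerset.1 hr h)
        simp only [hpr, false_and, if_false, zero_add, Finset.mem_insert_self, true_and,
          logSize_insert hpr, hw, Finset.prod_insert hpr, le_sub_iff_add_le]
        split_ifs
        · ring
        · rfl
    _ ≤ ∑ p ∈ P, ∑ r ∈ P.powerset,
          if Real.log p ≤ ℓ - logSize r then w r * (sieveWeight Z p * Real.log p) else 0 := by
        refine Finset.sum_le_sum fun p hp => ?_
        refine Finset.sum_le_sum_of_subset_of_nonneg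
          (Finset.powerset_mono.2 (Finset.erase_subset p P)) fun r hr _ => ?_
        split_ifs
        · exact mul_nonneg (hw0 r hr) (mul_nonneg (hS.weight_nonneg hp) (hlog p))
        · rfl
    _ = ∑ r ∈ P.powerset, w r *
          ∑ p ∈ P with Real.log (p : ℕ) ≤ ℓ - logSize r, sieveWeight Z p * Real.log p := by
        rw [Finset.sum_comm]
        refine Finset.sum_congr rfl fun r _ => ?_
        rw [← Finset.sum_filter, Finset.mul_sum]
    _ = ∑ r ∈ P.powerset with logSize r ≤ ℓ, w r *
          ∑ p ∈ P with Real.log (p : ℕ) ≤ ℓ - logSize r, sieveWeight Z p * Real.log p := by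
        refine (Finset.sum_filter_of_ne fun r _ hne => ?_).symm
        by_contra! h
        refine hne ?_
        rw [Finset.filter_false_of_mem]
        · simp
        · intro p _
          have := hlog p
          linarith
    _ ≤ ∑ r ∈ P.powerset with logSize r ≤ ℓ, w r * (2 * k * (ℓ - logSize r + Real.log 4)) := by
        refine Finset.sum_le_sum fun r hr => ?_
        rw [Finset.mem_filter] at hr
        refine mul_le_mul_of_nonneg_left ?_ (hw0 r hr.1)
        have hM := sum_log_div_le (s := {p ∈ P | Real.log p ≤ ℓ - logSize r})
          (sub_nonneg.2 hr.2) (fun p hp => hS.prime p (Finset.mem_filter.1 hp).1)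
          (fun p hp => (Finset.mem_filter.1 hp).2)
        refine le_trans ?_ (mul_le_mul_of_nonneg_left hM (by positivity))
        rw [Finset.mul_sum]
        refine Finset.sum_le_sum fun p hp => ?_
        have := mul_le_mul_of_nonneg_right (hS.weight_le (Finset.mem_filter.1 hp).1) (hlog p)
        exact this.trans (le_of_eq (by ring))
    _ = _ := by
        rw [Finset.mul_sum]
        refine Finset.sum_congr rfl fun r _ => ?_
        ring

theorem sum_weight_le (hS : IsSieve k P Z) (hℓ : 0 < ℓ)
    (hℓk : 2 * k * (2 * k + 2) * Real.log 4 ≤ ℓ) :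
    ∑ r ∈ P.powerset with logSize r ≤ ℓ, ∏ p ∈ r, sieveWeight Z p ≤
      (2 * k + 2) * ∑ r ∈ P.powerset, (∏ p ∈ r, sieveWeight Z p) * cutoff ℓ r := by
  have hmain := hS.sum_weight_mul_logSize_le ℓ
  have hT : ∑ r ∈ P.powerset with logSize r ≤ ℓ, (∏ p ∈ r, sieveWeight Z p) * cutoff ℓ r =
      ∑ r ∈ P.powerset, (∏ p ∈ r, sieveWeight Z p) * cutoff ℓ r :=
    Finset.sum_filter_of_ne fun r _ hne =>
      logSize_le_of_cutoff_ne_zero hℓ (right_ne_zero_of_mul hne)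
  rw [← hT]
  set H := ∑ r ∈ P.powerset with logSize r ≤ ℓ, ∏ p ∈ r, sieveWeight Z p with hH
  set T := ∑ r ∈ P.powerset with logSize r ≤ ℓ, (∏ p ∈ r, sieveWeight Z p) * cutoff ℓ r with hT'
  have hlogc : ∀ r ∈ P.powerset.filter (fun r => logSize r ≤ ℓ),
      logSize r = ℓ * (1 - cutoff ℓ r) := by
    intro r hr
    rw [cutoff_of_le hℓ (Finset.mem_filter.1 hr).2]
    field_simp
    ring
  have h1 : ∑ r ∈ P.powerset with logSize r ≤ ℓ, (∏ p ∈ r, sieveWeight Z p) * logSize r =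
      ℓ * (H - T) := by
    rw [hH, hT', ← Finset.sum_sub_distrib, Finset.mul_sum]
    refine Finset.sum_congr rfl fun r hr => ?_
    rw [hlogc r hr]
    ring
  have h2 : ∑ r ∈ P.powerset with logSize r ≤ ℓ,
      (∏ p ∈ r, sieveWeight Z p) * (ℓ - logSize r + Real.log 4) = ℓ * T + Real.log 4 * H := by
    rw [hH, hT', Finset.mul_sum, Finset.mul_sum, ← Finset.sum_add_distrib]
    refine Finset.sum_congr rfl fun r hr => ?_
    rw [hlogc r hr]
    ring
  rw [h1, h2] at hmain
  have hH0 : 0 ≤ H := Finset.sum_nonneg fun r hr =>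
    hS.prod_weight_nonneg (Finset.mem_powerset.1 (Finset.mem_filter.1 hr).1)
  have h3 := mul_le_mul_of_nonneg_right hℓk hH0
  have h4 : (2 * k + 1) * ℓ * H ≤ (2 * k + 1) * ℓ * ((2 * k + 2) * T) := by
    have h5 := mul_le_mul_of_nonneg_left hmain (show (0 : ℝ) ≤ 2 * k + 2 by positivity)
    linarith
  exact le_of_mul_le_mul_left h4 (by positivity)

/-- The mean value of the square of `∑ r, cutoff ℓ r * ∏ p ∈ r, sieveFun Z p`. -/
noncomputable def _root_.sieveMass (Z : ℕ → ℕ → Prop) (P : Finset ℕ) (ℓ : ℝ) : ℝ :=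
  ∑ r ∈ P.powerset, (∏ p ∈ r, sieveWeight Z p) * cutoff ℓ r ^ 2

/-- The same mean value, restricted to a removed class modulo `p`. -/
noncomputable def _root_.sieveMassAt (Z : ℕ → ℕ → Prop) (P : Finset ℕ) (ℓ : ℝ) (p : ℕ) : ℝ :=
  ∑ r ∈ (P.erase p).powerset,
    (∏ q ∈ r, sieveWeight Z q) * (cutoff ℓ r - cutoff ℓ (insert p r)) ^ 2

theorem sum_weight_le_mass (hS : IsSieve k P Z) (hℓ : 0 < ℓ)
    (hℓk : 2 * k * (2 * k + 2) * Real.log 4 ≤ ℓ) :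
    ∑ r ∈ P.powerset with logSize r ≤ ℓ, ∏ p ∈ r, sieveWeight Z p ≤
      (2 * k + 2) ^ 2 * sieveMass Z P ℓ := by
  have h1 := hS.sum_weight_le hℓ hℓk
  have hT : ∑ r ∈ P.powerset with logSize r ≤ ℓ, (∏ p ∈ r, sieveWeight Z p) * cutoff ℓ r =
      ∑ r ∈ P.powerset, (∏ p ∈ r, sieveWeight Z p) * cutoff ℓ r :=
    Finset.sum_filter_of_ne fun r _ hne =>
      logSize_le_of_cutoff_ne_zero hℓ (right_ne_zero_of_mul hne)
  have hQ : ∑ r ∈ P.powerset with logSize r ≤ ℓ, (∏ p ∈ r, sieveWeight Z p) * cutoff ℓ r ^ 2 =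
      sieveMass Z P ℓ :=
    Finset.sum_filter_of_ne fun r _ hne =>
      logSize_le_of_cutoff_ne_zero hℓ (pow_ne_zero_iff two_ne_zero |>.1 (right_ne_zero_of_mul hne))
  rw [← hT] at h1
  rw [← hQ]
  have hw0 : ∀ r ∈ P.powerset.filter (fun r => logSize r ≤ ℓ), 0 ≤ ∏ p ∈ r, sieveWeight Z p :=
    fun r hr => hS.prod_weight_nonneg (Finset.mem_powerset.1 (Finset.mem_filter.1 hr).1)
  have hcs := Finset.sum_sq_le_sum_mul_sum_of_sq_le_mul
    (P.powerset.filter (fun r => logSize r ≤ ℓ))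
    (r := fun r => (∏ p ∈ r, sieveWeight Z p) * cutoff ℓ r)
    (f := fun r => ∏ p ∈ r, sieveWeight Z p)
    (g := fun r => (∏ p ∈ r, sieveWeight Z p) * cutoff ℓ r ^ 2) hw0
    (fun r hr => mul_nonneg (hw0 r hr) (sq_nonneg _)) (fun r _ => le_of_eq (by ring))
  set H := ∑ r ∈ P.powerset with logSize r ≤ ℓ, ∏ p ∈ r, sieveWeight Z p
  set T := ∑ r ∈ P.powerset with logSize r ≤ ℓ, (∏ p ∈ r, sieveWeight Z p) * cutoff ℓ r
  set Q := ∑ r ∈ P.powerset with logSize r ≤ ℓ, (∏ p ∈ r, sieveWeight Z p) * cutoff ℓ r ^ 2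
  have hH0 : 0 < H := by
    have hmem : (∅ : Finset ℕ) ∈ P.powerset.filter (fun r => logSize r ≤ ℓ) := by
      rw [Finset.mem_filter]
      exact ⟨Finset.empty_mem_powerset P, by simpa [logSize] using hℓ.le⟩
    have := Finset.single_le_sum hw0 hmem
    simp only [Finset.prod_empty] at this
    exact lt_of_lt_of_le one_pos this
  have h2 : H ^ 2 ≤ (2 * k + 2) ^ 2 * T ^ 2 := by
    rw [← mul_pow]
    gcongr
  have h3 : H * H ≤ H * ((2 * k + 2) ^ 2 * Q) := by
    calc H * H = H ^ 2 := by ring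
      _ ≤ (2 * k + 2) ^ 2 * T ^ 2 := h2
      _ ≤ (2 * k + 2) ^ 2 * (H * Q) := by gcongr
      _ = _ := by ring
  exact le_of_mul_le_mul_left h3 hH0

theorem one_le_mass (hS : IsSieve k P Z) : 1 ≤ sieveMass Z P ℓ := by
  have := Finset.single_le_sum (s := P.powerset)
    (f := fun r => (∏ p ∈ r, sieveWeight Z p) * cutoff ℓ r ^ 2)
    (fun r hr => mul_nonneg (hS.prod_weight_nonneg (Finset.mem_powerset.1 hr)) (sq_nonneg _))
    (Finset.empty_mem_powerset P)
  simpa [sieveMass, cutoff, logSize] using this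

theorem massAt_le_mass (hS : IsSieve k P Z) (hℓ : 0 < ℓ) (p : ℕ) :
    sieveMassAt Z P ℓ p ≤ sieveMass Z P ℓ := by
  have hsub := Finset.powerset_mono.2 (Finset.erase_subset p P)
  calc sieveMassAt Z P ℓ p
      ≤ ∑ r ∈ (P.erase p).powerset, (∏ q ∈ r, sieveWeight Z q) * cutoff ℓ r ^ 2 := by
        refine Finset.sum_le_sum fun r hr => ?_
        have hpr : p ∉ r := fun h => Finset.notMem_erase p P (Finset.mem_powerset.1 hr h)
        have h1 := cutoff_insert_le hℓ hpr
        have h2 := cutoff_nonneg ℓ (insert p r)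
        refine mul_le_mul_of_nonneg_left ?_
          (hS.prod_weight_nonneg (Finset.mem_powerset.1 (hsub hr)))
        exact pow_le_pow_left₀ (by linarith) (by linarith) 2
    _ ≤ _ := Finset.sum_le_sum_of_subset_of_nonneg hsub fun r hr _ =>
        mul_nonneg (hS.prod_weight_nonneg (Finset.mem_powerset.1 hr)) (sq_nonneg _)

theorem massAt_le (hS : IsSieve k P Z) (hℓ : 0 < ℓ)
    (hℓk : 2 * k * (2 * k + 2) * Real.log 4 ≤ ℓ) (p : ℕ) :
    sieveMassAt Z P ℓ p ≤ ((2 * k + 2) * Real.log p / ℓ) ^ 2 * sieveMass Z P ℓ := by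
  have hsub := Finset.powerset_mono.2 (Finset.erase_subset p P)
  have hlog : 0 ≤ Real.log p / ℓ := div_nonneg (Real.log_natCast_nonneg p) hℓ.le
  calc sieveMassAt Z P ℓ p
      = ∑ r ∈ (P.erase p).powerset with logSize r ≤ ℓ,
          (∏ q ∈ r, sieveWeight Z q) * (cutoff ℓ r - cutoff ℓ (insert p r)) ^ 2 := by
        refine (Finset.sum_filter_of_ne fun r hr hne => ?_).symm
        have hpr : p ∉ r := fun h => Finset.notMem_erase p P (Finset.mem_powerset.1 hr h)
        by_contra! h
        have h1 := cutoff_insert_le hℓ hpr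
        have h2 := cutoff_nonneg ℓ (insert p r)
        rw [cutoff_of_lt hℓ h] at hne h1
        exact hne (by rw [le_antisymm h1 h2]; ring)
    _ ≤ ∑ r ∈ (P.erase p).powerset with logSize r ≤ ℓ,
          (∏ q ∈ r, sieveWeight Z q) * (Real.log p / ℓ) ^ 2 := by
        refine Finset.sum_le_sum fun r hr => ?_
        rw [Finset.mem_filter] at hr
        have hpr : p ∉ r := fun h => Finset.notMem_erase p P (Finset.mem_powerset.1 hr.1 h)
        have h1 := cutoff_insert_le hℓ hpr
        have h2 := cutoff_sub_cutoff_insert_le hℓ hpr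
        refine mul_le_mul_of_nonneg_left ?_
          (hS.prod_weight_nonneg (Finset.mem_powerset.1 (hsub hr.1)))
        exact pow_le_pow_left₀ (by linarith) h2 2
    _ ≤ ∑ r ∈ P.powerset with logSize r ≤ ℓ,
          (∏ q ∈ r, sieveWeight Z q) * (Real.log p / ℓ) ^ 2 :=
        Finset.sum_le_sum_of_subset_of_nonneg (Finset.filter_subset_filter _ hsub) fun r hr _ =>
          mul_nonneg (hS.prod_weight_nonneg
            (Finset.mem_powerset.1 (Finset.mem_filter.1 hr).1)) (sq_nonneg _)
    _ ≤ ((2 * k + 2) ^ 2 * sieveMass Z P ℓ) * (Real.log p / ℓ) ^ 2 := by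
        rw [← Finset.sum_mul]
        gcongr
        exact hS.sum_weight_le_mass hℓ hℓk
    _ = _ := by ring

/-- On average over the sieve measure, few sifting primes divide a given linear form. -/
theorem sum_massAt_div_le (hS : IsSieve k P Z) (hℓ : 0 < ℓ)
    (hℓk : 2 * k * (2 * k + 2) * Real.log 4 ≤ ℓ) (hP : ∀ p ∈ P, Real.log p ≤ ℓ) {s : ℝ}
    (hs : 1 ≤ s) (hks : 2 * k + 2 ≤ s ^ 2) (hℓs : s ^ 2 * Real.log 4 ≤ ℓ) :
    ∑ p ∈ P, sieveMassAt Z P ℓ p / p ≤ (2 * s + 4) * sieveMass Z P ℓ := by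
  have hQ : 0 ≤ sieveMass Z P ℓ := zero_le_one.trans hS.one_le_mass
  have hs0 : 0 < s := one_pos.trans_le hs
  have hlog4 : 0 ≤ Real.log 4 := Real.log_nonneg (by norm_num)
  have hblock : ∀ v : ℝ, 1 ≤ v → v ≤ s ^ 2 →
      ∑ p ∈ P with Real.log (p : ℕ) ≤ ℓ / v, Real.log p / p ≤ ℓ / v + ℓ / s ^ 2 := by
    intro v hv hvs
    have h1 := sum_log_div_le (s := {p ∈ P | Real.log p ≤ ℓ / v}) (u := ℓ / v) (by positivity)
      (fun p hp => hS.prime p (Finset.mem_filter.1 hp).1) (fun p hp => (Finset.mem_filter.1 hp).2)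
    have h2 : Real.log 4 ≤ ℓ / s ^ 2 := by
      rw [le_div_iff₀ (by positivity)]
      linarith
    linarith
  have hpt : ∀ p ∈ P, sieveMassAt Z P ℓ p / p ≤ sieveMass Z P ℓ *
      ((s ^ 2 / ℓ) * (if Real.log p ≤ ℓ / s ^ 2 then Real.log p / p else 0) +
        (s ^ 2 / ℓ) * (if Real.log p ≤ ℓ / s then Real.log p / p else 0) +
        (s / ℓ) * (if Real.log p ≤ ℓ / 1 then Real.log p / p else 0)) := by
    intro p hp
    have hp0 : (0 : ℝ) < p := by exact_mod_cast (hS.prime p hp).pos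
    have hlog : 0 ≤ Real.log p := Real.log_natCast_nonneg p
    have hterm : ∀ (c v : ℝ), 0 ≤ c →
        0 ≤ c * (if Real.log p ≤ v then Real.log p / p else 0) := by
      intro c v hc
      refine mul_nonneg hc ?_
      split_ifs
      · positivity
      · exact le_rfl
    have ha := hterm (s ^ 2 / ℓ) (ℓ / s ^ 2) (by positivity)
    have hb := hterm (s ^ 2 / ℓ) (ℓ / s) (by positivity)
    have hc := hterm (s / ℓ) (ℓ / 1) (by positivity)
    have hle := hS.massAt_le_mass hℓ p
    have hreduce : ∀ x : ℝ, sieveMassAt Z P ℓ p ≤ x * sieveMass Z P ℓ →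
        sieveMassAt Z P ℓ p / p ≤ sieveMass Z P ℓ * (x / p) := by
      intro x hx
      rw [mul_div_assoc', mul_comm (sieveMass Z P ℓ)]
      gcongr
    by_cases h1 : Real.log p ≤ ℓ / s ^ 2
    · have hu : s ^ 2 * Real.log p / ℓ ≤ 1 := by
        rw [div_le_one hℓ]
        rw [le_div_iff₀ (by positivity)] at h1
        linarith
      refine (hreduce (s ^ 2 * Real.log p / ℓ) ?_).trans ?_
      · refine (hS.massAt_le hℓ hℓk p).trans (mul_le_mul_of_nonneg_right ?_ hQ)
        calc ((2 * k + 2) * Real.log p / ℓ) ^ 2 ≤ (s ^ 2 * Real.log p / ℓ) ^ 2 := by gcongr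
          _ ≤ s ^ 2 * Real.log p / ℓ := by
            have : 0 ≤ s ^ 2 * Real.log p / ℓ := by positivity
            nlinarith
      · refine mul_le_mul_of_nonneg_left ?_ hQ
        rw [if_pos h1] at ha ⊢
        have : s ^ 2 * Real.log p / ℓ / p = s ^ 2 / ℓ * (Real.log p / p) := by ring
        linarith
    · rw [not_le] at h1
      have h1' : 1 ≤ s ^ 2 * Real.log p / ℓ := by
        rw [le_div_iff₀ hℓ]
        rw [div_lt_iff₀ (by positivity)] at h1
        linarith
      by_cases h2 : Real.log p ≤ ℓ / s
      · refine (hreduce (s ^ 2 * Real.log p / ℓ) ?_).trans ?_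
        · exact hle.trans (le_mul_of_one_le_left hQ h1')
        · refine mul_le_mul_of_nonneg_left ?_ hQ
          rw [if_pos h2] at hb ⊢
          have : s ^ 2 * Real.log p / ℓ / p = s ^ 2 / ℓ * (Real.log p / p) := by ring
          linarith
      · rw [not_le] at h2
        have h2' : 1 ≤ s * Real.log p / ℓ := by
          rw [le_div_iff₀ hℓ]
          rw [div_lt_iff₀ (by positivity)] at h2
          linarith
        refine (hreduce (s * Real.log p / ℓ) ?_).trans ?_
        · exact hle.trans (le_mul_of_one_le_left hQ h2')
        · refine mul_le_mul_of_nonneg_left ?_ hQ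
          have h3 : Real.log p ≤ ℓ / 1 := by simpa using hP p hp
          rw [if_pos h3] at hc ⊢
          have : s * Real.log p / ℓ / p = s / ℓ * (Real.log p / p) := by ring
          linarith
  have hs2 : s ≤ s ^ 2 := by nlinarith
  have hb1 := hblock (s ^ 2) (by nlinarith) le_rfl
  have hb2 := hblock s hs hs2
  have hb3 := hblock 1 le_rfl (by nlinarith)
  refine (Finset.sum_le_sum hpt).trans ?_
  rw [← Finset.mul_sum, Finset.sum_add_distrib, Finset.sum_add_distrib, ← Finset.mul_sum,
    ← Finset.mul_sum, ← Finset.mul_sum, ← Finset.sum_filter, ← Finset.sum_filter,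
    ← Finset.sum_filter, mul_comm]
  refine mul_le_mul_of_nonneg_right ?_ hQ
  calc _ ≤ s ^ 2 / ℓ * (ℓ / s ^ 2 + ℓ / s ^ 2) + s ^ 2 / ℓ * (ℓ / s + ℓ / s ^ 2) +
        s / ℓ * (ℓ / 1 + ℓ / s ^ 2) := by gcongr
    _ = 2 * s + 3 + 1 / s := by
        field_simp
        ring
    _ ≤ 2 * s + 4 := by
        have : 1 / s ≤ 1 := (div_le_one hs0).2 hs
        linarith

end IsSieve

theorem card_filter_dvd_linear_le_one {m a b : ℕ} (ham : m.Coprime a) :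
    #{t ∈ range m | m ∣ a * t + b} ≤ 1 := by
  rw [Finset.card_le_one]
  intro x hx y hy
  simp only [mem_filter, mem_range] at hx hy
  have h1 : a * x + b ≡ a * y + b [MOD m] :=
    (Nat.modEq_zero_iff_dvd.2 hx.2).trans (Nat.modEq_zero_iff_dvd.2 hy.2).symm
  exact (Nat.ModEq.cancel_left_of_coprime ham (Nat.ModEq.add_right_cancel' b h1)).eq_of_lt_of_lt
    hx.1 hy.1

theorem sum_dvd_linear_div_le {m a b : ℕ} (ham : m.Coprime a) :
    (∑ t ∈ range m, if m ∣ a * t + b then (1 : ℝ) else 0) / m ≤ 1 / m := by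
  gcongr
  rw [Finset.sum_boole]
  exact_mod_cast card_filter_dvd_linear_le_one ham

theorem dvd_linear_add_period {m d a b t : ℕ} (h : d ∣ m) :
    d ∣ a * (t + m) + b ↔ d ∣ a * t + b := by
  rw [show a * (t + m) + b = a * t + b + a * m by ring]
  exact (Nat.dvd_add_iff_left (h.mul_left a)).symm

theorem isSieve_linear {k : ℕ} {P : Finset ℕ} {a b : Fin k → ℕ} (hP : ∀ p ∈ P, p.Prime)
    (hPk : ∀ p ∈ P, 2 * k < p) (ha : ∀ p ∈ P, ∀ i, ¬ p ∣ a i) :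
    IsSieve k P (fun p t => ∃ i, p ∣ a i * t + b i) where
  prime := hP
  two_mul_lt := hPk
  periodic p _ t := exists_congr fun _ => dvd_linear_add_period dvd_rfl
  card_le p hp := by
    classical
    unfold siftedCard
    calc _ ≤ #(Finset.univ.biUnion fun i : Fin k => {t ∈ range p | p ∣ a i * t + b i}) := by
          refine Finset.card_le_card fun t ht => ?_
          simp only [mem_filter, mem_biUnion, mem_univ, true_and] at ht ⊢
          obtain ⟨ht, i, hi⟩ := ht
          exact ⟨i, ht, hi⟩
      _ ≤ #(Finset.univ : Finset (Fin k)) * 1 :=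
          Finset.card_biUnion_le_card_mul _ _ _ fun i _ =>
            card_filter_dvd_linear_le_one (((hP p hp).coprime_iff_not_dvd).2 (ha p hp i))
      _ = k := by simp

/-- The nonnegative weight of the sieve. -/
noncomputable def sieveMeasure (Z : ℕ → ℕ → Prop) (P : Finset ℕ) (ℓ : ℝ) (t : ℕ) : ℝ :=
  (∑ r ∈ P.powerset, cutoff ℓ r * ∏ p ∈ r, sieveFun Z p t) ^ 2

theorem prod_le_of_cutoff_ne_zero {R : ℕ} (hR : 1 < R) {r : Finset ℕ} (hr : ∀ p ∈ r, p.Prime)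
    (h : cutoff (Real.log R) r ≠ 0) : ∏ p ∈ r, p ≤ R := by
  have h1 := logSize_le_of_cutoff_ne_zero (Real.log_pos (by exact_mod_cast hR)) h
  have hpos : ∀ p ∈ r, (0 : ℝ) < p := fun p hp => by exact_mod_cast (hr p hp).pos
  rw [logSize, ← Real.log_prod fun p hp => (hpos p hp).ne',
    Real.log_le_log_iff (Finset.prod_pos hpos) (by positivity), ← Nat.cast_prod] at h1
  exact Nat.cast_le.1 h1

namespace IsSieve

variable {k : ℕ} {P : Finset ℕ} {Z : ℕ → ℕ → Prop} {R : ℕ}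

theorem le_sum_sieveMeasure (hS : IsSieve k P Z) (hR : 1 < R) (T N : ℕ) :
    N * sieveMass Z P (Real.log R) - 2 * (R : ℝ) ^ 4 ≤
      ∑ t ∈ Ico T (T + N), sieveMeasure Z P (Real.log R) t := by
  have hℓ : 0 < Real.log R := Real.log_pos (by exact_mod_cast hR)
  have h := hS.abs_sum_sq_sub_le (z := cutoff (Real.log R)) (R := R)
    (fun r _ => by
      rw [abs_of_nonneg (cutoff_nonneg _ r)]
      exact cutoff_le_one hℓ r)
    (fun r hr => prod_le_of_cutoff_ne_zero hR fun p hp => hS.prime p (hr hp))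
    one_pos (fun p _ => Nat.coprime_one_left p) (f := fun _ => 1) (fun _ => rfl) (fun _ => by simp)
    T N
  have h1 := (abs_le.1 h).1
  simp only [one_mul, range_one, sum_const, card_singleton, one_smul, Nat.cast_one, div_one,
    mul_one] at h1
  unfold sieveMeasure sieveMass
  linarith

theorem sum_sieveMeasure_dvd_le (hS : IsSieve k P Z) (hR : 1 < R) {p e a b : ℕ} (hp : p ∈ P)
    (he : e ≠ 0) (ha : ¬ p ∣ a) (hZ : ∀ t, p ∣ a * t + b → Z p t) (T N : ℕ) :
    ∑ t ∈ Ico T (T + N), (if p ^ e ∣ a * t + b then 1 else 0) *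
        sieveMeasure Z P (Real.log R) t ≤
      N * (1 / (p : ℝ) ^ e) * sieveMassAt Z P (Real.log R) p + 2 * (p : ℝ) ^ e * (R : ℝ) ^ 4 := by
  have hℓ : 0 < Real.log R := Real.log_pos (by exact_mod_cast hR)
  have hpp := hS.prime p hp
  have hS' := hS.mono (Finset.erase_subset p P)
  have hnot : ∀ r ⊆ P.erase p, p ∉ r := fun r hr h => Finset.notMem_erase p P (hr h)
  have h := hS'.abs_sum_sq_sub_le
    (z := fun r => cutoff (Real.log R) r - cutoff (Real.log R) (insert p r)) (R := R)
    (fun r hr => by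
      have h1 := cutoff_insert_le hℓ (hnot r hr)
      have h2 := cutoff_nonneg (Real.log R) (insert p r)
      have h3 := cutoff_le_one hℓ r
      rw [abs_of_nonneg (by linarith)]
      linarith)
    (fun r hr hne => by
      refine prod_le_of_cutoff_ne_zero hR (fun q hq => hS'.prime q (hr hq)) fun h0 => hne ?_
      have h1 := cutoff_insert_le hℓ (hnot r hr)
      have h2 := cutoff_nonneg (Real.log R) (insert p r)
      linarith)
    (m := p ^ e) (pow_pos hpp.pos e)
    (fun q hq => Nat.Coprime.pow_left e
      ((Nat.coprime_primes hpp (hS'.prime q hq)).2 (Finset.ne_of_mem_erase hq).symm))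
    (f := fun t => if p ^ e ∣ a * t + b then 1 else 0)
    (fun t => by simp only [dvd_linear_add_period dvd_rfl])
    (fun t => by split_ifs <;> simp) T N
  have hsum : ∑ t ∈ Ico T (T + N), (if p ^ e ∣ a * t + b then 1 else 0) *
      sieveMeasure Z P (Real.log R) t =
      ∑ t ∈ Ico T (T + N), (if p ^ e ∣ a * t + b then 1 else 0) *
        (∑ r ∈ (P.erase p).powerset, (cutoff (Real.log R) r - cutoff (Real.log R) (insert p r)) *
          ∏ q ∈ r, sieveFun Z q t) ^ 2 := by
    refine Finset.sum_congr rfl fun t _ => ?_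
    split_ifs with hd
    · have hpt : sieveFun Z p t = -1 := if_pos (hZ t ((dvd_pow_self p he).trans hd))
      rw [sieveMeasure, sum_powerset_erase hp]
      congr 2
      refine Finset.sum_congr rfl fun r hr => ?_
      rw [Finset.prod_insert (hnot r (Finset.mem_powerset.1 hr)), hpt]
      ring
    · simp
  have h1 := (abs_le.1 h).2
  have hmean := sum_dvd_linear_div_le (b := b)
    (Nat.Coprime.pow_left e ((hpp.coprime_iff_not_dvd).2 ha))
  have hQ : 0 ≤ sieveMassAt Z P (Real.log R) p := Finset.sum_nonneg fun r hr =>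
    mul_nonneg (hS'.prod_weight_nonneg (Finset.mem_powerset.1 hr)) (sq_nonneg _)
  have h2 := mul_le_mul_of_nonneg_right
    (mul_le_mul_of_nonneg_left hmean (Nat.cast_nonneg (α := ℝ) N)) hQ
  rw [hsum]
  unfold sieveMassAt at h2 ⊢
  push_cast at h1 h2 ⊢
  linarith

end IsSieve

theorem sum_one_div_sq_le {P : Finset ℕ} {D : ℕ} (hD : D ≠ 0) (hP : ∀ p ∈ P, D < p) :
    ∑ p ∈ P, 1 / (p : ℝ) ^ 2 ≤ 1 / (D : ℝ) := by
  have hsub : P ⊆ Ioc D (P.sup id ⊔ D) := fun p hp => by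
    rw [mem_Ioc]
    exact ⟨hP p hp, le_sup_of_le_left (Finset.le_sup (f := id) hp)⟩
  calc ∑ p ∈ P, 1 / (p : ℝ) ^ 2 ≤ ∑ p ∈ Ioc D (P.sup id ⊔ D), 1 / (p : ℝ) ^ 2 :=
        Finset.sum_le_sum_of_subset_of_nonneg hsub fun _ _ _ => by positivity
    _ ≤ 1 / (D : ℝ) := by
        have h := sum_Ioc_inv_sq_le_sub (α := ℝ) hD (le_sup_right : D ≤ P.sup id ⊔ D)
        have h0 : (0 : ℝ) ≤ ((P.sup id ⊔ D : ℕ) : ℝ)⁻¹ := by positivity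
        simp only [one_div]
        linarith

theorem exists_few_sifting_primes {k s K D R : ℕ} (hs : 1 ≤ s) (hks : 2 * k + 2 ≤ s ^ 2)
    (hK : K = k * (2 * s + 4) + 2) (hD : D = K * k + 1) {P : Finset ℕ} {a b : Fin k → ℕ}
    (hP : ∀ p ∈ P, p.Prime) (hPD : ∀ p ∈ P, D < p) (hPR : ∀ p ∈ P, p ≤ R)
    (ha : ∀ p ∈ P, ∀ i, ¬ p ∣ a i) (hR : 2 * K + 2 * k + 2 * K * k < R)
    (hℓk : 2 * k * (2 * k + 2) * Real.log 4 ≤ Real.log R)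
    (hℓs : (s : ℝ) ^ 2 * Real.log 4 ≤ Real.log R) (T : ℕ) :
    ∃ t ∈ Ico T (T + R ^ 8), ∑ i, #{p ∈ P | p ∣ a i * t + b i} < K ∧
      ∀ i, ∀ p ∈ P, ¬ p ^ 2 ∣ a i * t + b i := by
  have hR1 : 1 < R := by omega
  have hℓ : 0 < Real.log R := Real.log_pos (by exact_mod_cast hR1)
  set Z : ℕ → ℕ → Prop := fun p t => ∃ i, p ∣ a i * t + b i with hZ
  have hS : IsSieve k P Z := isSieve_linear hP (fun p hp => by
    have := hPD p hp
    have : 2 * k ≤ K * k := Nat.mul_le_mul_right k (by omega)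
    omega) ha
  set μ := sieveMeasure Z P (Real.log R) with hμ
  set Q := sieveMass Z P (Real.log R) with hQdef
  set N := R ^ 8 with hN
  have hμ0 : ∀ t, 0 ≤ μ t := fun t => sq_nonneg _
  have hQ1 : 1 ≤ Q := hS.one_le_mass
  by_contra! hcon
  have hpoint : ∀ t ∈ Ico T (T + N), (K : ℝ) * μ t ≤
      ∑ i, ∑ p ∈ P, (if p ^ 1 ∣ a i * t + b i then 1 else 0) * μ t +
        K * ∑ i, ∑ p ∈ P, (if p ^ 2 ∣ a i * t + b i then 1 else 0) * μ t := by
    intro t ht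
    simp only [← Finset.sum_mul, ← mul_assoc, ← add_mul]
    refine mul_le_mul_of_nonneg_right ?_ (hμ0 t)
    simp only [Finset.sum_boole, pow_one]
    norm_cast
    by_cases hlt : ∑ i, #{p ∈ P | p ∣ a i * t + b i} < K
    · obtain ⟨i, p, hp, hd⟩ := hcon t ht hlt
      have h1 : 1 ≤ #{p ∈ P | p ^ 2 ∣ a i * t + b i} :=
        Finset.card_pos.2 ⟨p, Finset.mem_filter.2 ⟨hp, hd⟩⟩
      have h2 := Finset.single_le_sum (f := fun i => #{p ∈ P | p ^ 2 ∣ a i * t + b i})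
        (fun _ _ => Nat.zero_le _) (Finset.mem_univ i)
      exact le_add_left (Nat.le_mul_of_pos_right K (by omega))
    · exact le_add_right (not_lt.1 hlt)
  have hsum := Finset.sum_le_sum hpoint
  rw [← Finset.mul_sum, Finset.sum_add_distrib, ← Finset.mul_sum] at hsum
  have hcardP : (#P : ℝ) ≤ R := by
    have : P ⊆ Icc 1 R := fun p hp => Finset.mem_Icc.2 ⟨(hP p hp).one_le, hPR p hp⟩
    have := Finset.card_le_card this
    rw [Nat.card_Icc, Nat.add_sub_cancel] at this
    exact_mod_cast this
  have hRpos : (0 : ℝ) < R := by positivity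
  have hdiv : ∀ e : ℕ, e ≠ 0 → ∀ x : ℝ,
      ∑ p ∈ P, 1 / (p : ℝ) ^ e * sieveMassAt Z P (Real.log R) p ≤ x →
      ∑ t ∈ Ico T (T + N), ∑ i, ∑ p ∈ P, (if p ^ e ∣ a i * t + b i then 1 else 0) * μ t ≤
        k * (N * x + 2 * (R : ℝ) ^ (e + 5)) := by
    intro e he x hx
    have hi : ∀ i : Fin k, ∑ p ∈ P, ∑ t ∈ Ico T (T + N),
        (if p ^ e ∣ a i * t + b i then 1 else 0) * μ t ≤ N * x + 2 * (R : ℝ) ^ (e + 5) := by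
      intro i
      calc _ ≤ ∑ p ∈ P, (N * (1 / (p : ℝ) ^ e * sieveMassAt Z P (Real.log R) p) +
            2 * (R : ℝ) ^ (e + 4)) := by
            refine Finset.sum_le_sum fun p hp => ?_
            refine (hS.sum_sieveMeasure_dvd_le hR1 hp he (ha p hp i) (fun t ht => ⟨i, ht⟩)
              T N).trans ?_
            have hpR : (p : ℝ) ≤ R := by exact_mod_cast hPR p hp
            rw [mul_assoc, pow_add, ← mul_assoc 2]
            gcongr
        _ ≤ N * x + R * (2 * (R : ℝ) ^ (e + 4)) := by
            rw [Finset.sum_add_distrib, ← Finset.mul_sum, Finset.sum_const, nsmul_eq_mul]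
            gcongr
        _ = _ := by ring
    rw [Finset.sum_comm]
    have := Finset.sum_le_card_nsmul (Finset.univ : Finset (Fin k)) _ _ fun i _ => hi i
    simp only [Finset.card_univ, Fintype.card_fin, nsmul_eq_mul] at this
    refine le_trans (le_of_eq (Finset.sum_congr rfl fun i _ => ?_)) this
    rw [Finset.sum_comm]
  have h1 := hdiv 1 one_ne_zero ((2 * s + 4) * Q) (by
    refine le_trans (le_of_eq (Finset.sum_congr rfl fun p _ => ?_))
      (hS.sum_massAt_div_le hℓ hℓk (fun p hp => ?_) (s := s) (by exact_mod_cast hs)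
        (by exact_mod_cast hks) hℓs)
    · rw [pow_one]
      ring
    · have := (hP p hp).pos
      have hpR := hPR p hp
      gcongr)
  have h2 := hdiv 2 two_ne_zero (1 / D * Q) (by
    calc _ ≤ ∑ p ∈ P, 1 / (p : ℝ) ^ 2 * Q := by
          gcongr with p hp
          exact hS.massAt_le_mass hℓ p
      _ ≤ 1 / D * Q := by
          rw [← Finset.sum_mul]
          gcongr
          exact sum_one_div_sq_le (by omega) hPD)
  have h0 := hS.le_sum_sieveMeasure hR1 T N
  have hKD : (K : ℝ) * k * (1 / D) ≤ 1 := by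
    have hD0 : (0 : ℝ) < D := by exact_mod_cast (show 0 < D by omega)
    rw [mul_one_div, div_le_one hD0]
    exact_mod_cast (show K * k ≤ D by omega)
  have hN0 : (0 : ℝ) ≤ N := Nat.cast_nonneg _
  have hfin : (K : ℝ) * (N * Q - 2 * (R : ℝ) ^ 4) ≤
      k * (N * ((2 * s + 4) * Q) + 2 * (R : ℝ) ^ (1 + 5)) +
        K * (k * (N * (1 / D * Q) + 2 * (R : ℝ) ^ (2 + 5))) := by
    refine le_trans ?_ (hsum.trans ?_)
    · gcongr
    · gcongr
  have hK' : (K : ℝ) = k * (2 * s + 4) + 2 := by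
    rw [hK]
    push_cast
    ring
  have h3 : (K : ℝ) * k * (1 / D) * (N * Q) ≤ 1 * (N * Q) := by gcongr
  have h4 : (N : ℝ) * Q ≤ 2 * K * (R : ℝ) ^ 4 + 2 * k * (R : ℝ) ^ 6 + 2 * K * k * (R : ℝ) ^ 7 := by
    have h5 : (K : ℝ) * (N * Q) = (k * (2 * s + 4) + 2) * (N * Q) := by rw [hK']
    generalize 1 / (D : ℝ) = δ at h3 hfin
    linear_combination hfin + h3 - h5
  have hR1' : (1 : ℝ) ≤ R := by exact_mod_cast hR1.le
  have h5 : (N : ℝ) * Q ≤ (2 * K + 2 * k + 2 * K * k) * (R : ℝ) ^ 7 := by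
    have e1 : (R : ℝ) ^ 4 ≤ (R : ℝ) ^ 7 := pow_le_pow_right₀ hR1' (by norm_num)
    have e2 : (R : ℝ) ^ 6 ≤ (R : ℝ) ^ 7 := pow_le_pow_right₀ hR1' (by norm_num)
    have e3 : 2 * K * (R : ℝ) ^ 4 ≤ 2 * K * (R : ℝ) ^ 7 := by gcongr
    have e4 : 2 * k * (R : ℝ) ^ 6 ≤ 2 * k * (R : ℝ) ^ 7 := by gcongr
    linarith
  have h6 : ((2 * K + 2 * k + 2 * K * k : ℕ) : ℝ) * (R : ℝ) ^ 7 < R * (R : ℝ) ^ 7 := by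
    gcongr
  have h7 : (N : ℝ) ≤ N * Q := le_mul_of_one_le_right hN0 hQ1
  have h8 : (N : ℝ) = R * (R : ℝ) ^ 7 := by
    rw [hN]
    push_cast
    ring
  push_cast at h6
  linarith

/-- A number below `R ^ 9` none of whose prime factors up to `R` is repeated. -/
theorem length_primeFactorsList_le {R n : ℕ} (hn : n ≠ 0) (hnR : n < R ^ 9) {P : Finset ℕ}
    (hP : ∀ p, p.Prime → p ∣ n → p ≤ R → p ∈ P) (hsq : ∀ p ∈ P, ¬ p ^ 2 ∣ n) :
    n.primeFactorsList.length ≤ #{p ∈ P | p ∣ n} + 8 := by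
  have hmem : ∀ p ∈ n.primeFactorsList, p.Prime ∧ p ∣ n := fun p hp =>
    ⟨Nat.prime_of_mem_primeFactorsList hp, Nat.dvd_of_mem_primeFactorsList hp⟩
  rw [List.length_eq_length_filter_add (fun p => decide (p ≤ R))]
  refine Nat.add_le_add ?_ ?_
  · have hnodup : (n.primeFactorsList.filter fun p => decide (p ≤ R)).Nodup := by
      rw [List.nodup_iff_count_le_one]
      intro p
      by_contra! h
      have hp : p ∈ n.primeFactorsList.filter fun p => decide (p ≤ R) :=
        List.count_pos_iff.1 (by omega)
      rw [List.mem_filter, decide_eq_true_eq] at hp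
      have hpn := hmem p hp.1
      have h2 := h.trans_le (List.Sublist.count_le p List.filter_sublist)
      rw [Nat.primeFactorsList_count_eq] at h2
      exact hsq p (hP p hpn.1 hpn.2 hp.2) ((hpn.1.pow_dvd_iff_le_factorization hn).2 h2)
    rw [← List.toFinset_card_of_nodup hnodup]
    refine Finset.card_le_card fun p hp => ?_
    rw [List.mem_toFinset, List.mem_filter, decide_eq_true_eq] at hp
    have hpn := hmem p hp.1
    exact Finset.mem_filter.2 ⟨hP p hpn.1 hpn.2 hp.2, hpn.2⟩
  · set l := n.primeFactorsList.filter fun p => !decide (p ≤ R) with hl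
    have h1 : R ^ l.length ≤ l.prod := by
      refine List.pow_card_le_prod l R fun p hp => ?_
      rw [hl, List.mem_filter] at hp
      have := hp.2
      simp only [Bool.not_eq_true', decide_eq_false_iff_not, not_le] at this
      exact this.le
    have h2 : l.prod ∣ n := by
      have := (List.filter_sublist (l := n.primeFactorsList)
        (p := fun p => !decide (p ≤ R))).prod_dvd_prod
      rwa [Nat.prod_primeFactorsList hn] at this
    have h3 : R ^ l.length < R ^ 9 :=
      (h1.trans (Nat.le_of_dvd (Nat.pos_of_ne_zero hn) h2)).trans_lt hnR
    have hR : 0 < R := by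
      by_contra! h0
      simp only [Nat.le_zero] at h0
      subst h0
      simp at hnR
    by_contra! h9
    exact h3.not_ge (Nat.pow_le_pow_right hR h9)

/-- Simultaneous almost primes in `k` linear forms, with `O(k ^ (3 / 2))` prime factors in total. -/
theorem exists_sum_length_primeFactorsList_lt {k s : ℕ} (hs : 1 ≤ s) (hks : 2 * k + 2 ≤ s ^ 2) :
    ∃ D : ℕ, ∀ (A : ℕ) (a b : Fin k → ℕ),
      (∀ p, p.Prime → p ≤ D → p ∣ A) → (∀ p, p.Prime → ¬ p ∣ A → ∀ i, ¬ p ∣ a i) →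
      (∀ p, p.Prime → p ∣ A → ∀ i t, ¬ p ∣ a i * t + b i) →
      ∀ T, ∃ t, T ≤ t ∧
        ∑ i, (a i * t + b i).primeFactorsList.length < k * (2 * s + 4) + 2 + k * 8 := by
  set K := k * (2 * s + 4) + 2 with hK
  refine ⟨K * k + 1, fun A a b hA ha hb T => ?_⟩
  obtain ⟨R, hR1, hR2, hR3, hR4, hR5⟩ : ∃ R : ℕ, 2 * K + 2 * k + 2 * K * k < R ∧ T ≤ R ∧
      2 * ∑ i, (a i + b i) < R ∧ 2 * k * (2 * k + 2) * Real.log 4 ≤ Real.log R ∧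
      (s : ℝ) ^ 2 * Real.log 4 ≤ Real.log R := by
    have hlog : Filter.Tendsto (fun R : ℕ => Real.log R) Filter.atTop Filter.atTop :=
      Real.tendsto_log_atTop.comp tendsto_natCast_atTop_atTop
    exact ((Filter.eventually_gt_atTop _).and ((Filter.eventually_ge_atTop T).and
      ((Filter.eventually_gt_atTop _).and ((hlog.eventually_ge_atTop _).and
        (hlog.eventually_ge_atTop _))))).exists
  set P := {p ∈ range (R + 1) | p.Prime ∧ ¬ p ∣ A} with hPdef
  have hPmem : ∀ p, p ∈ P ↔ p ≤ R ∧ p.Prime ∧ ¬ p ∣ A := by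
    intro p
    rw [hPdef, Finset.mem_filter, Finset.mem_range, Nat.lt_succ_iff]
  obtain ⟨t, ht, hcard, hsq⟩ := exists_few_sifting_primes (P := P) (a := a) (b := b) hs hks hK rfl
    (fun p hp => ((hPmem p).1 hp).2.1)
    (fun p hp => by
      by_contra! h
      exact ((hPmem p).1 hp).2.2 (hA p ((hPmem p).1 hp).2.1 h))
    (fun p hp => ((hPmem p).1 hp).1)
    (fun p hp => ha p ((hPmem p).1 hp).2.1 ((hPmem p).1 hp).2.2) hR1 hR4 hR5 T
  rw [Finset.mem_Ico] at ht
  refine ⟨t, ht.1, ?_⟩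
  have hlen : ∀ i, (a i * t + b i).primeFactorsList.length ≤
      #{p ∈ P | p ∣ a i * t + b i} + 8 := by
    intro i
    by_cases h0 : a i * t + b i = 0
    · simp [h0]
    refine length_primeFactorsList_le (R := R) h0 ?_ (fun p hp hpn hpR => ?_) (hsq i)
    · have h1 : a i + b i ≤ ∑ i, (a i + b i) :=
        Finset.single_le_sum (f := fun i => a i + b i) (fun _ _ => Nat.zero_le _)
          (Finset.mem_univ i)
      have hRpos : 0 < R := by omega
      have hR8 : R ≤ R ^ 8 := Nat.le_self_pow (by norm_num) R
      have ht2 : t + 1 ≤ 2 * R ^ 8 := by omega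
      calc a i * t + b i ≤ (a i + b i) * (t + 1) := by nlinarith
        _ ≤ (a i + b i) * (2 * R ^ 8) := by gcongr
        _ = 2 * (a i + b i) * R ^ 8 := by ring
        _ < R * R ^ 8 := by
          gcongr
          omega
        _ = R ^ 9 := by ring
    · exact (hPmem p).2 ⟨hpR, hp, fun h => hb p hp h i t hpn⟩
  calc ∑ i, (a i * t + b i).primeFactorsList.length
      ≤ ∑ i, (#{p ∈ P | p ∣ a i * t + b i} + 8) := Finset.sum_le_sum fun i _ => hlen i
    _ = ∑ i, #{p ∈ P | p ∣ a i * t + b i} + k * 8 := by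
        rw [Finset.sum_add_distrib]
        simp
    _ < _ := by omega

open ArithmeticFunction

theorem exists_strictMono_sub_dvd (k : ℕ) :
    ∃ h : Fin k → ℕ, StrictMono h ∧ (∀ i, 0 < h i) ∧ ∀ i j, i < j → h j - h i ∣ h i := by
  induction k with
  | zero => exact ⟨Fin.elim0, fun i => i.elim0, fun i => i.elim0, fun i => i.elim0⟩
  | succ k ih =>
    obtain ⟨h, hmono, hpos, hdvd⟩ := ih
    have hN : ∀ i, h i ∣ ∏ i, h i := fun i => Finset.dvd_prod_of_mem h (Finset.mem_univ i)
    refine ⟨Fin.cons (∏ i, h i) fun i => ∏ i, h i + h i, ?_, ?_, ?_⟩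
    · intro i j hij
      cases j using Fin.cases with
      | zero => exact absurd hij (Fin.not_lt_zero i)
      | succ j =>
        cases i using Fin.cases with
        | zero => simpa using hpos j
        | succ i => simpa using hmono (Fin.succ_lt_succ_iff.1 hij)
    · intro i
      cases i using Fin.cases with
      | zero =>
        rw [Fin.cons_zero]
        exact Finset.prod_pos fun i _ => hpos i
      | succ i => simpa using Or.inr (hpos i)
    · intro i j hij
      cases j using Fin.cases with
      | zero => exact absurd hij (Fin.not_lt_zero i)
      | succ j =>
        cases i using Fin.cases with
        | zero => simpa using hN j
        | succ i =>
          have := hdvd i j (Fin.succ_lt_succ_iff.1 hij)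
          simpa [Nat.add_sub_add_left] using dvd_add (this.trans (hN i)) this

/-- A residue class divisible by `V` in which each shift by `h j` has a prescribed exact
power of the prime `q j`. -/
theorem exists_dvd_modEq_pow {k V : ℕ} (hV : V ≠ 0) {h q : Fin k → ℕ} (e : Fin k → ℕ)
    (hq : ∀ i, (q i).Prime) (hqi : Function.Injective q) (hqV : ∀ i, (q i).Coprime V) :
    ∃ m, V ∣ m ∧ ∀ j, m + h j ≡ q j ^ e j [MOD q j ^ (e j + 1)] := by
  obtain ⟨m, hm⟩ := Nat.chineseRemainderOfFinset
    (fun o : Option (Fin k) => o.elim 0 fun j => q j ^ e j + (q j ^ (e j + 1) * h j - h j))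
    (fun o => o.elim V fun j => q j ^ (e j + 1)) Finset.univ
    (fun o _ => by
      cases o with
      | none => exact hV
      | some j => exact pow_ne_zero _ (hq j).ne_zero)
    (fun o _ o' _ hne => by
      cases o with
      | none =>
        cases o' with
        | none => exact absurd rfl hne
        | some j => exact ((hqV j).pow_left _).symm
      | some i =>
        cases o' with
        | none => exact (hqV i).pow_left _
        | some j =>
          exact Nat.Coprime.pow _ _ ((Nat.coprime_primes (hq i) (hq j)).2 fun he =>
            hne (congrArg some (hqi he))))
  refine ⟨m, Nat.modEq_zero_iff_dvd.1 (hm none (Finset.mem_univ _)), fun j => ?_⟩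
  have h1 : m ≡ q j ^ e j + (q j ^ (e j + 1) * h j - h j) [MOD q j ^ (e j + 1)] :=
    hm (some j) (Finset.mem_univ _)
  have h2 : h j ≤ q j ^ (e j + 1) * h j :=
    Nat.le_mul_of_pos_left _ (pow_pos (hq j).pos _)
  refine (h1.add_right (h j)).trans ?_
  rw [add_assoc, Nat.sub_add_cancel h2]
  simp [Nat.ModEq]

theorem exists_linear_forms {k : ℕ} (D : ℕ) {h : Fin k → ℕ} (hinj : Function.Injective h)
    (hpos : ∀ i, 0 < h i) :
    ∃ (A E m : ℕ) (a b c : Fin k → ℕ), 0 < A ∧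
      (∀ p, p.Prime → p ≤ D → p ∣ A) ∧ (∀ p, p.Prime → ¬ p ∣ A → ∀ i, ¬ p ∣ a i) ∧
      (∀ p, p.Prime → p ∣ A → ∀ i t, ¬ p ∣ a i * t + b i) ∧
      (∀ i, c i ≠ 0 ∧ (c i).primeFactorsList.length = E ∧ h i ∣ c i) ∧
      ∀ i t, c i * (a i * t + b i) = A * t + m + h i := by
  set H := ∏ i, h i with hH
  have hH0 : 0 < H := Finset.prod_pos fun i _ => hpos i
  have hhH : ∀ i, h i ∣ H := fun i => Finset.dvd_prod_of_mem h (Finset.mem_univ i)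
  set V := H * (H * D.factorial) with hV
  have hV0 : 0 < V := by positivity
  have hhV : ∀ i, h i ∣ V := fun i => (hhH i).mul_right _
  have hpV : ∀ p, p.Prime → p ∣ V → ∀ i, h i * p ∣ V := by
    intro p hp hpV i
    refine mul_dvd_mul (hhH i) ?_
    rcases hp.dvd_mul.1 hpV with h1 | h1
    · exact h1.mul_right _
    · exact h1
  set q : Fin k → ℕ := fun i => Nat.nth Nat.Prime (V + i) with hq
  have hqp : ∀ i, (q i).Prime := fun i => Nat.prime_nth_prime _
  have hqV : ∀ i, V < q i := fun i => by
    have := Nat.add_two_le_nth_prime (V + i)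
    simp only [hq]
    omega
  have hqi : Function.Injective q := fun i j hij => by
    have := Nat.nth_injective Nat.infinite_setOfPred_prime hij
    exact Fin.ext (by omega)
  have hqh : ∀ i j, h i < q j := fun i j => (Nat.le_of_dvd hV0 (hhV i)).trans_lt (hqV j)
  have hqcop : ∀ (i) (x : ℕ), 0 < x → x < q i → (q i).Coprime x := fun i x h0 hx =>
    ((hqp i).coprime_iff_not_dvd).2 (Nat.not_dvd_of_pos_of_lt h0 hx)
  set E := ∑ i, (h i).primeFactorsList.length + 1 with hE
  set e : Fin k → ℕ := fun i => E - (h i).primeFactorsList.length with he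
  have hlen : ∀ i, (h i).primeFactorsList.length + e i = E ∧ 1 ≤ e i := by
    intro i
    have := Finset.single_le_sum (f := fun i => (h i).primeFactorsList.length)
      (fun _ _ => Nat.zero_le _) (Finset.mem_univ i)
    simp only [he]
    omega
  obtain ⟨m, hmV, hmq⟩ := exists_dvd_modEq_pow (h := h) hV0.ne' e hqp hqi
    fun i => hqcop i V hV0 (hqV i)
  have hqm : ∀ i, q i ^ e i ∣ m + h i := fun i =>
    (((hmq i).of_dvd (pow_dvd_pow _ (Nat.le_succ _))).dvd_iff dvd_rfl).2 dvd_rfl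
  set A := V * ∏ i, q i ^ (e i + 1) with hA
  have hqA : ∀ i, q i ^ (e i + 1) ∣ A := fun i =>
    (Finset.dvd_prod_of_mem (fun i => q i ^ (e i + 1)) (Finset.mem_univ i)).mul_left V
  have hVA : V ∣ A := dvd_mul_right _ _
  have hcA : ∀ i, h i * q i ^ e i ∣ A := fun i => mul_dvd_mul (hhV i)
    ((pow_dvd_pow _ (Nat.le_succ _)).trans
      (Finset.dvd_prod_of_mem (fun i => q i ^ (e i + 1)) (Finset.mem_univ i)))
  have hcm : ∀ i, h i * q i ^ e i ∣ m + h i := fun i =>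
    Nat.Coprime.mul_dvd_of_dvd_of_dvd ((hqcop i _ (hpos i) (hqh i i)).symm.pow_right _)
      (dvd_add ((hhV i).trans hmV) dvd_rfl) (hqm i)
  have hform : ∀ i t, h i * q i ^ e i * (A / (h i * q i ^ e i) * t +
      (m + h i) / (h i * q i ^ e i)) = A * t + m + h i := by
    intro i t
    rw [mul_add, ← mul_assoc, Nat.mul_div_cancel' (hcA i), Nat.mul_div_cancel' (hcm i), add_assoc]
  refine ⟨A, E, m, fun i => A / (h i * q i ^ e i), fun i => (m + h i) / (h i * q i ^ e i),
    fun i => h i * q i ^ e i, ?_, ?_, ?_, ?_, ?_, hform⟩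
  · exact Nat.mul_pos hV0 (Finset.prod_pos fun i _ => pow_pos (hqp i).pos _)
  · intro p hp hpD
    exact (((hp.dvd_factorial.2 hpD).mul_left H).mul_left H).trans hVA
  · intro p _ hpA i hpa
    exact hpA (hpa.trans (Nat.div_dvd_of_dvd (hcA i)))
  · intro p hp hpA i t hdvd
    have hmul := mul_dvd_mul_left (h i * q i ^ e i) hdvd
    rw [hform i t] at hmul
    rcases hp.dvd_mul.1 hpA with hpV' | hpq
    · have h1 : h i * p ∣ A * t + m + h i := (mul_dvd_mul_right (dvd_mul_right _ _) p).trans hmul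
      have h2 : h i * p ∣ A * t + m :=
        dvd_add (((hpV p hp hpV' i).trans hVA).mul_right t) ((hpV p hp hpV' i).trans hmV)
      have h3 := (Nat.dvd_add_right h2).1 h1
      have h4 := Nat.le_of_dvd (hpos i) h3
      have := hp.two_le
      have := hpos i
      nlinarith
    · obtain ⟨j, -, hpj⟩ := (hp.prime.dvd_finsetProd_iff _).1 hpq
      obtain rfl := (Nat.prime_dvd_prime_iff_eq hp (hqp j)).1 (hp.dvd_of_dvd_pow hpj)
      by_cases hij : j = i
      · subst hij
        have h1 : q j ^ (e j + 1) ∣ A * t + (m + h j) := by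
          rw [← add_assoc, pow_succ]
          exact (mul_dvd_mul_right (dvd_mul_left _ _) _).trans hmul
        have h2 := (Nat.dvd_add_right ((hqA j).mul_right t)).1 h1
        have h3 := ((hmq j).dvd_iff dvd_rfl).1 h2
        have := (Nat.pow_dvd_pow_iff_le_right (hqp j).one_lt).1 h3
        omega
      · have h1 : q j ∣ A * t + (m + h i) := by
          rw [← add_assoc]
          exact (dvd_mul_left _ _).trans hmul
        have h2 := (Nat.dvd_add_right (hpA.mul_right t)).1 h1
        have h3 : q j ∣ m + h j := (dvd_pow_self _ (by have := (hlen j).2; omega)).trans (hqm j)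
        have h4 : m + h j ≡ m + h i [MOD q j] :=
          (Nat.modEq_zero_iff_dvd.2 h3).trans (Nat.modEq_zero_iff_dvd.2 h2).symm
        exact hij (hinj ((Nat.ModEq.add_left_cancel' m h4).eq_of_lt_of_lt (hqh j j) (hqh i j)))
  · intro i
    have hq0 : q i ^ e i ≠ 0 := pow_ne_zero _ (hqp i).ne_zero
    refine ⟨mul_ne_zero (hpos i).ne' hq0, ?_, dvd_mul_right _ _⟩
    rw [← cardFactors_apply, cardFactors_mul (hpos i).ne' hq0, cardFactors_apply_prime_pow (hqp i),
      cardFactors_apply, (hlen i).1]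

theorem sum_range_le_sum_of_injective {k : ℕ} {f : Fin k → ℕ} (hf : Function.Injective f) :
    ∑ i ∈ range k, i ≤ ∑ i, f i := by
  have hf' : Function.Injective fun i => (f i : ℤ) := Nat.cast_injective.comp hf
  have h := Finset.sum_range_le_sum (s := Finset.univ.image fun i => (f i : ℤ)) (c := 0) (by simp)
  rw [Finset.card_image_of_injective _ hf', Finset.sum_image fun i _ j _ hij => hf' hij] at h
  simp only [Finset.card_univ, Fintype.card_fin, zero_add] at h
  rw [← Nat.cast_le (α := ℤ)]
  push_cast
  exact h

theorem exists_bound_length_primeFactorsList_eq_succ :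
    ∃ C : ℕ, ∀ T : ℕ, ∃ y, T ≤ y ∧ y.primeFactorsList.length = (y + 1).primeFactorsList.length ∧
      y.primeFactorsList.length ≤ C := by
  obtain ⟨D, hD⟩ := exists_sum_length_primeFactorsList_lt (k := 100) (s := 15) (by norm_num)
    (by norm_num)
  obtain ⟨h, hmono, hpos, hdvd⟩ := exists_strictMono_sub_dvd 100
  obtain ⟨A, E, m, a, b, c, hA0, hA, ha, hb, hc, hform⟩ :=
    exists_linear_forms D hmono.injective hpos
  refine ⟨E + 4202, fun T => ?_⟩
  set M := ∑ i, h i with hM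
  obtain ⟨t, hTt, hsum⟩ := hD A a b hA ha hb (M * (T + 1))
  have hninj : ¬ Function.Injective fun i => (a i * t + b i).primeFactorsList.length := by
    intro hinj
    have h1 := sum_range_le_sum_of_injective hinj
    have h2 : ∑ i ∈ range 100, i = 4950 := by decide
    omega
  obtain ⟨i, j, hij, hlen⟩ : ∃ i j, i < j ∧
      (a i * t + b i).primeFactorsList.length = (a j * t + b j).primeFactorsList.length := by
    simp only [Function.Injective, not_forall] at hninj
    obtain ⟨i, j, h1, hne⟩ := hninj
    rcases lt_or_gt_of_ne hne with h2 | h2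
    · exact ⟨i, j, h2, h1⟩
    · exact ⟨j, i, h2, h1.symm⟩
  have hbound : (a i * t + b i).primeFactorsList.length ≤ 4202 := by
    have h1 := Finset.single_le_sum (f := fun i => (a i * t + b i).primeFactorsList.length)
      (fun _ _ => Nat.zero_le _) (Finset.mem_univ i)
    omega
  have hΩ : ∀ i, (A * t + m + h i).primeFactorsList.length =
      E + (a i * t + b i).primeFactorsList.length := by
    intro i
    have h0 : a i * t + b i ≠ 0 := by
      intro h0
      have := hform i t
      have := hpos i
      rw [h0] at *
      omega
    rw [← hform i t, ← cardFactors_apply, cardFactors_mul (hc i).1 h0, cardFactors_apply,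
      cardFactors_apply, (hc i).2.1]
  have hhij := hmono hij
  set d := h j - h i with hd
  have hd0 : d ≠ 0 := by omega
  have hdi : d ∣ A * t + m + h i := by
    rw [← hform i t]
    exact ((hdvd i j hij).trans (hc i).2.2).mul_right _
  obtain ⟨y, hy⟩ := hdi
  have hy1 : A * t + m + h j = d * (y + 1) := by
    rw [mul_add, ← hy]
    omega
  have hyT : T + 1 ≤ y := by
    have h1 : d ≤ M := by
      have := Finset.single_le_sum (f := h) (fun _ _ => Nat.zero_le _) (Finset.mem_univ j)
      omega
    have hM0 : 0 < M := by omega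
    by_contra! hlt
    have h2 : d * y ≤ M * T := Nat.mul_le_mul h1 (by omega)
    nlinarith
  have hΩi := hΩ i
  have hΩj := hΩ j
  rw [hy, ← cardFactors_apply, cardFactors_mul hd0 (by omega)] at hΩi
  rw [hy1, ← cardFactors_apply, cardFactors_mul hd0 (by omega)] at hΩj
  refine ⟨y, by omega, ?_⟩
  rw [← cardFactors_apply, ← cardFactors_apply]
  omega

/-- For every positive integer `n`, there is a positive integer `B` such that
`Ω(x) = Ω(x + n) = B` for infinitely many positive integers `x`. -/
theorem stmt_19 (n : ℕ) (hn : 0 < n) :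
    ∃ B : ℕ, 0 < B ∧
      {x : ℕ | 0 < x ∧ x.primeFactorsList.length = B ∧
        (x + n).primeFactorsList.length = B}.Infinite := by
  obtain ⟨C, hC⟩ := exists_bound_length_primeFactorsList_eq_succ
  choose f hfT hfeq hfC using hC
  obtain ⟨B, hB⟩ := Finite.exists_infinite_fiber fun T =>
    (⟨(f T).primeFactorsList.length, Nat.lt_succ_of_le (hfC T)⟩ : Fin (C + 1))
  have hB' := Set.infinite_coe_iff.1 hB
  have hpos : ∀ T, 2 ≤ T → 0 < (f T).primeFactorsList.length := fun T hT => by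
    rw [List.length_pos_iff, ne_eq, Nat.primeFactorsList_eq_nil]
    have := hfT T
    omega
  have hmem : ∀ T ∈ (fun T => (⟨(f T).primeFactorsList.length, Nat.lt_succ_of_le (hfC T)⟩ :
      Fin (C + 1))) ⁻¹' {B}, (f T).primeFactorsList.length = B := fun T hT => congrArg Fin.val hT
  obtain ⟨T, hT, hT2⟩ := hB'.exists_gt 1
  refine ⟨(n.primeFactorsList.length + B : ℕ), ?_, ?_⟩
  · have := hpos T hT2
    rw [hmem T hT] at this
    omega
  refine Set.infinite_of_forall_exists_gt fun X => ?_
  obtain ⟨T, hT, hTX⟩ := hB'.exists_gt (X + 1)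
  have hf0 : X < f T := by
    have := hfT T
    omega
  refine ⟨n * f T, ⟨Nat.mul_pos hn (by omega), ?_, ?_⟩,
    hf0.trans_le (Nat.le_mul_of_pos_left _ hn)⟩
  · rw [← cardFactors_apply, cardFactors_mul hn.ne' (by omega), cardFactors_apply,
      cardFactors_apply, hmem T hT]
  · rw [← Nat.mul_succ, ← cardFactors_apply, cardFactors_mul hn.ne' (by omega), cardFactors_apply,
      cardFactors_apply, Nat.succ_eq_add_one, ← hfeq, hmem T hT]
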